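/- arXiv:1505.05599 — 5 statements merged into one kernel-verified Lean document; each statement's English description precedes it below -/
import Mathlib

section
/- There is an absolute constant C such that for every undirected unweighted graph G on n vertices and every pair set P ⊆ V×V in which every pair lies in the same connected component, there exists a subgraph H of G that is a pairwise distance preserver of (G,P) and has at most C·(n^{2/3}|P|^{2/3} + n·|P|^{1/3}) edges. -/
namespace SDP

open SimpleGraph

variable {V : Type}

theorem tri {H : SimpleGraph V} {u v w : V} (h1 : H.Reachable u v) (h2 : H.Reachable v w) :
    H.dist u w ≤ H.dist u v + H.dist v w := by
  obtain ⟨p, hp⟩ := h1.exists_walk_length_eq_dist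
  obtain ⟨q, hq⟩ := h2.exists_walk_length_eq_dist
  have := dist_le (p.append q)
  rw [Walk.length_append] at this
  omega

theorem adj_le {H : SimpleGraph V} {u v : V} (h : H.Adj u v) : H.dist u v ≤ 1 :=
  (dist_eq_one_iff_adj.2 h).le

/-- `(a,b)` is the only edge at its level among the `s`-`t` geodesics of `H`. -/
structure Crit (H : SimpleGraph V) (s t a b : V) : Prop where
  adj : H.Adj a b
  ra : H.Reachable s a
  rt : H.Reachable s t
  eq : H.dist s a + 1 + H.dist b t = H.dist s t
  uniq : ∀ a' b', H.Adj a' b' → H.Reachable s a' → H.dist s a' = H.dist s a →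
    H.dist b' t = H.dist b t → a' = a ∧ b' = b

theorem Crit.on {H : SimpleGraph V} {s t a b : V} (h : Crit H s t a b) :
    H.dist s a + H.dist a t = H.dist s t := by
  have h1 := tri h.ra (h.ra.symm.trans h.rt)
  have h2 := tri h.adj.reachable ((h.adj.symm.reachable.trans h.ra.symm).trans h.rt)
  have h3 := adj_le h.adj
  have := h.eq
  omega

/-- any vertex `z` on an `s`-`t` geodesic strictly after `a` is reached through `b`. -/
theorem Crit.through {H : SimpleGraph V} {s t y b z : V} (h : Crit H s t y b)
    (hz : H.Reachable s z) (hon : H.dist s z + H.dist z t = H.dist s t)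
    (hlt : H.dist s y < H.dist s z) : H.dist s y + 1 + H.dist b z = H.dist s z := by
  obtain ⟨w, hw⟩ := hz.exists_walk_length_eq_dist
  set i := H.dist s y with hi
  have hil : i < w.length := by omega
  have hadj := w.adj_getVert_succ hil
  have h1 : H.dist s (w.getVert i) ≤ i := by
    have := dist_le (w.take i)
    rw [Walk.take_length] at this
    omega
  have h2 : H.dist (w.getVert (i+1)) z ≤ w.length - (i+1) := by
    have := dist_le (w.drop (i+1))
    rw [Walk.drop_length] at this
    omega
  have r1 : H.Reachable s (w.getVert i) := ⟨w.take i⟩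
  have r2 : H.Reachable (w.getVert (i+1)) z := ⟨w.drop (i+1)⟩
  have zt : H.Reachable z t := hz.symm.trans h.rt
  have t1 := tri r2 zt
  have t2 := tri r1 (hadj.reachable.trans (r2.trans zt))
  have t3 := tri hadj.reachable (r2.trans zt)
  have t4 := adj_le hadj
  have t5 := tri r1 (hadj.reachable.trans r2)
  have t6 := tri hadj.reachable r2
  have := h.eq
  obtain ⟨e1, e2⟩ := h.uniq _ _ hadj r1 (by omega) (by omega)
  rw [e2] at h2 t6 t1
  rw [e1] at t6 t5
  have t7 : H.dist y b ≤ 1 := adj_le h.adj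
  omega

theorem Crit.between {H : SimpleGraph V} {s t y b z : V} (h : Crit H s t y b)
    (hz : H.Reachable s z) (hon : H.dist s z + H.dist z t = H.dist s t)
    (hlt : H.dist s y < H.dist s z) :
    H.dist y z = 1 + H.dist b z ∧ H.dist s y + H.dist y z = H.dist s z := by
  have h1 := h.through hz hon hlt
  have bz : H.Reachable b z := (h.adj.symm.reachable.trans h.ra.symm).trans hz
  have h2 := tri h.adj.reachable bz
  have h3 := adj_le h.adj
  have h4 := tri h.ra (h.adj.reachable.trans bz)
  omega

theorem Crit.first {H : SimpleGraph V} {s t y b z c : V} (h : Crit H s t y b)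
    (hz : H.Reachable s z) (hon : H.dist s z + H.dist z t = H.dist s t)
    (hlt : H.dist s y < H.dist s z) (hc : H.Adj y c) (hcz : H.dist c z + 1 ≤ H.dist y z) :
    c = b := by
  have h1 := h.through hz hon hlt
  have h2 := h.between hz hon hlt
  have cz : H.Reachable c z := (hc.symm.reachable.trans h.ra.symm).trans hz
  have zt : H.Reachable z t := hz.symm.trans h.rt
  have t1 := tri cz zt
  have t2 := tri h.ra (hc.reachable.trans (cz.trans zt))
  have t3 := tri hc.reachable (cz.trans zt)
  have t4 := adj_le hc
  have := h.eq
  exact (h.uniq y c hc h.ra rfl (by omega)).2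

theorem Crit.inj {H : SimpleGraph V} {s t a b a' b' : V} (h : Crit H s t a b)
    (h' : Crit H s t a' b') (e : H.dist s a = H.dist s a') : a' = a ∧ b' = b := by
  have := h.eq
  have := h'.eq
  exact h.uniq a' b' h'.adj h'.ra e.symm (by omega)

/-- existence of critical orientation -/
theorem exists_crit {H : SimpleGraph V} {s t : V} (e : Sym2 V) (hr : H.Reachable s t)
    (hall : ∀ w : H.Walk s t, w.length = H.dist s t → e ∈ w.edges) :
    ∃ a b, e = s(a, b) ∧ Crit H s t a b := by
  obtain ⟨w, hw⟩ := hr.exists_walk_length_eq_dist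
  have he := hall w hw
  obtain ⟨i, hi, hei⟩ : ∃ i, i < w.length ∧ e = s(w.getVert i, w.getVert (i+1)) := by
    induction e using Sym2.ind with
    | _ u v =>
      obtain ⟨i, hi, h⟩ := w.mk_mem_edges_iff_exists.1 he
      exact ⟨i, hi, h.symm⟩
  have hadj := w.adj_getVert_succ hi
  have h1 : H.dist s (w.getVert i) ≤ i := by
    have := dist_le (w.take i)
    rw [Walk.take_length] at this
    omega
  have h2 : H.dist (w.getVert (i+1)) t ≤ w.length - (i+1) := by
    have := dist_le (w.drop (i+1))
    rw [Walk.drop_length] at this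
    omega
  have r1 : H.Reachable s (w.getVert i) := ⟨w.take i⟩
  have r2 : H.Reachable (w.getVert (i+1)) t := ⟨w.drop (i+1)⟩
  generalize w.getVert i = a at *
  generalize w.getVert (i+1) = b at *
  have t1 := tri r1 (hadj.reachable.trans r2)
  have t2 := tri hadj.reachable r2
  have t3 := adj_le hadj
  have t4 := tri (r1.trans hadj.reachable) r2
  refine ⟨a, b, hei, hadj, r1, hr, by omega, ?_⟩
  intro a' b' hab ra ea eb
  obtain ⟨w1, hw1⟩ := ra.exists_walk_length_eq_dist
  have rb : H.Reachable b' t := (hab.symm.reachable.trans ra.symm).trans hr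
  obtain ⟨w2, hw2⟩ := rb.exists_walk_length_eq_dist
  have := hall (w1.append (Walk.cons hab w2)) (by
    rw [Walk.length_append, Walk.length_cons]; omega)
  rw [Walk.edges_append, Walk.edges_cons, List.mem_append, List.mem_cons] at this
  rcases this with h | h | h
  · exfalso
    rw [hei] at h
    have hb := Walk.snd_mem_support_of_mem_edges w1 h
    classical
    have l1 := dist_le (w1.takeUntil b hb)
    have l2 := w1.length_takeUntil_le_length hb
    omega
  · rw [hei] at h
    rcases Sym2.eq_iff.1 h with ⟨e1, e2⟩ | ⟨e1, e2⟩
    · exact ⟨e1.symm, e2.symm⟩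
    · exfalso
      subst e1 e2
      omega
  · exfalso
    rw [hei] at h
    have ha := Walk.fst_mem_support_of_mem_edges w2 h
    classical
    have l1 := dist_le (w2.dropUntil a ha)
    have l2 := w2.length_dropUntil_le_length ha
    omega
open Finset in
theorem counting {V Q : Type} [Fintype V] [Fintype Q] [DecidableEq V] [DecidableEq Q]
    (B : Q → V → V → Prop) [∀ q y z, Decidable (B q y z)]
    (I : Q → V → Prop) [∀ q z, Decidable (I q z)]
    (N : V → Finset V) (d : ℕ) (hd : 0 < d)
    (hBI : ∀ q y z, B q y z → I q z)
    (hN : ∀ z, (N z).card ≤ d) (hN' : ∀ q z, I q z → (N z).card = d)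
    (h1 : ∀ q1 z1 z2 r, I q1 z1 → r ∈ N z1 → r ∈ N z2 →
      ((univ : Finset (V × Q)).filter
        (fun x => x.2 ≠ q1 ∧ B q1 x.1 z1 ∧ B x.2 x.1 z2)).card ≤ 5)
    (h2 : ∀ q z1 r y, B q y z1 → r ∈ N z1 →
      ((univ : Finset V).filter (fun z2 => B q y z2 ∧ r ∈ N z2)).card ≤ 5)
    (T M : ℝ) (hT : T = ∑ q, ∑ y, ∑ z, if B q y z then (1:ℝ) else 0)
    (hM : M = ∑ q, ∑ z, if I q z then (1:ℝ) else 0) :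
    d * T ^ 2 ≤ 10 * (Fintype.card V : ℝ) ^ 2 * (d * M + T) := by
  set n : ℝ := (Fintype.card V : ℝ) with hn
  have hd' : (0:ℝ) < d := by exact_mod_cast hd
  let b : Q → V → V → ℝ := fun q y z => if B q y z then 1 else 0
  let c : V → V → ℝ := fun z r => if r ∈ N z then 1 else 0
  have b0 : ∀ q y z, 0 ≤ b q y z := fun q y z => by dsimp [b]; split_ifs <;> norm_num
  have c0 : ∀ z r, 0 ≤ c z r := fun z r => by dsimp [c]; split_ifs <;> norm_num
  let ind : V → ℝ := fun r => ∑ z, c z r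
  have ind0 : ∀ r, 0 ≤ ind r := fun r => sum_nonneg fun z _ => c0 z r
  let om : V → ℝ := fun r => ind r + d
  have om0 : ∀ r, 0 < om r := fun r => by have := ind0 r; dsimp [om]; linarith
  have csum : ∀ z, ∑ r, c z r = (N z).card := by
    intro z; simp [c]
  have omsum : ∑ r, om r ≤ 2 * n * d := by
    dsimp [om, ind]
    rw [sum_add_distrib, sum_comm]
    simp only [csum, sum_const, card_univ, nsmul_eq_mul]
    have : ∑ z, ((N z).card : ℝ) ≤ ∑ z : V, (d:ℝ) := sum_le_sum fun z _ => by exact_mod_cast hN z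
    simp only [sum_const, card_univ, nsmul_eq_mul] at this
    linarith
  let w : V → V → ℝ := fun y r => ∑ q, ∑ z, b q y z * c z r
  have wsum : ∑ y, ∑ r, w y r = d * T := by
    dsimp [w]
    have : ∀ y, ∑ r, ∑ q, ∑ z, b q y z * c z r = ∑ q, ∑ z, d * b q y z := by
      intro y
      rw [sum_comm]
      refine sum_congr rfl fun q _ => ?_
      rw [sum_comm]
      refine sum_congr rfl fun z _ => ?_
      rw [← mul_sum, csum]
      dsimp [b]
      split_ifs with h
      · rw [hN' q z (hBI _ _ _ h)]; ring
      · ring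
    simp only [this]
    rw [sum_comm, hT, mul_sum]
    refine sum_congr rfl fun q _ => ?_
    rw [mul_sum]
    refine sum_congr rfl fun q _ => ?_
    rw [mul_sum]
  -- Cauchy-Schwarz
  have cs : (d * T) ^ 2 ≤ (∑ y, ∑ r, (w y r) ^ 2 / om r) * (n * ∑ r, om r) := by
    have := sum_sq_le_sum_mul_sum_of_sq_le_mul (univ : Finset (V × V))
      (r := fun x => w x.1 x.2) (f := fun x => (w x.1 x.2) ^ 2 / om x.2) (g := fun x => om x.2)
      (fun x _ => div_nonneg (sq_nonneg _) (om0 _).le) (fun x _ => (om0 _).le)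
      (fun x _ => by have := (om0 x.2).ne'; apply le_of_eq; field_simp)
    rw [← univ_product_univ, sum_product, sum_product, sum_product, wsum] at this
    simpa using this
  -- second-moment bound
  have key1 : ∀ q1 z1 r, (∑ y, b q1 y z1 * c z1 r *
      ∑ q2, ∑ z2, (if q2 ≠ q1 then b q2 y z2 * c z2 r else 0))
      ≤ (if I q1 z1 then 1 else 0) * c z1 r * (5 * ind r) := by
    intro q1 z1 r
    by_cases hI : I q1 z1
    swap
    · have : ∀ y, b q1 y z1 = 0 := fun y => by
        dsimp [b]; rw [if_neg]; exact fun h => hI (hBI _ _ _ h)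
      simp [this, hI]
    by_cases hr : r ∈ N z1
    swap
    · have : c z1 r = 0 := by simp [c, hr]
      simp [this]
    have hc : c z1 r = 1 := by simp [c, hr]
    simp only [hI, hc, if_true, mul_one, one_mul]
    have e : (∑ y, b q1 y z1 * ∑ q2, ∑ z2, (if q2 ≠ q1 then b q2 y z2 * c z2 r else 0))
        = ∑ z2, c z2 r * ∑ y, ∑ q2, (if q2 ≠ q1 ∧ B q1 y z1 ∧ B q2 y z2 then 1 else 0) := by
      simp only [mul_sum]
      conv_rhs => rw [sum_comm]
      refine sum_congr rfl fun y _ => ?_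
      conv_rhs => rw [sum_comm]
      refine sum_congr rfl fun q2 _ => sum_congr rfl fun z2 _ => ?_
      dsimp [b]
      by_cases q2 = q1 <;> by_cases B q1 y z1 <;> by_cases B q2 y z2 <;> simp [*]
    rw [e]
    dsimp only [ind]
    rw [mul_sum]
    refine sum_le_sum fun z2 _ => ?_
    by_cases hr2 : r ∈ N z2
    · have := h1 q1 z1 z2 r hI hr hr2
      rw [← sum_product', univ_product_univ, sum_boole]
      have h5 : (((univ : Finset (V × Q)).filter
        (fun x => x.2 ≠ q1 ∧ B q1 x.1 z1 ∧ B x.2 x.1 z2)).card : ℝ) ≤ 5 := by exact_mod_cast this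
      rw [mul_comm]
      exact mul_le_mul_of_nonneg_right h5 (c0 _ _)
    · have : c z2 r = 0 := by simp [c, hr2]
      simp [this]
  have key2 : ∀ q1 z1 r y, b q1 y z1 * c z1 r * ∑ z2, b q1 y z2 * c z2 r
      ≤ b q1 y z1 * c z1 r * 5 := by
    intro q1 z1 r y
    by_cases hB : B q1 y z1
    swap
    · simp [b, hB]
    by_cases hr : r ∈ N z1
    swap
    · simp [c, hr]
    have := h2 q1 z1 r y hB hr
    have e : ∑ z2, b q1 y z2 * c z2 r =
        (((univ : Finset V).filter (fun z2 => B q1 y z2 ∧ r ∈ N z2)).card : ℝ) := by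
      rw [← sum_boole]
      refine sum_congr rfl fun z2 _ => ?_
      dsimp [b, c]
      by_cases B q1 y z2 <;> by_cases r ∈ N z2 <;> simp [*]
    rw [e]
    have h5 : (((univ : Finset V).filter (fun z2 => B q1 y z2 ∧ r ∈ N z2)).card : ℝ) ≤ 5 := by
      exact_mod_cast this
    exact mul_le_mul_of_nonneg_left h5 (mul_nonneg (b0 _ _ _) (c0 _ _))
  have split : ∀ y r, (w y r) ^ 2 =
      (∑ q1, ∑ z1, b q1 y z1 * c z1 r * ∑ q2, ∑ z2, (if q2 ≠ q1 then b q2 y z2 * c z2 r else 0))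
      + ∑ q1, ∑ z1, b q1 y z1 * c z1 r * ∑ z2, b q1 y z2 * c z2 r := by
    intro y r
    rw [sq]
    conv_lhs => arg 1; dsimp only [w]
    rw [sum_mul, ← sum_add_distrib]
    refine sum_congr rfl fun q1 _ => ?_
    rw [sum_mul, ← sum_add_distrib]
    refine sum_congr rfl fun z1 _ => ?_
    rw [← mul_add]
    congr 1
    dsimp only [w]
    rw [← Finset.add_sum_erase univ _ (mem_univ q1), add_comm]
    congr 1
    rw [← Finset.add_sum_erase univ (fun q2 => ∑ z2, if q2 ≠ q1 then _ else _) (mem_univ q1)]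
    simp only [ne_eq, not_true_eq_false, if_false, sum_const_zero, zero_add]
    refine sum_congr rfl fun q2 hq2 => ?_
    simp [(mem_erase.1 hq2).1]
  have sm : ∀ r, ∑ y, (w y r) ^ 2 ≤
      (∑ q1, ∑ z1, (if I q1 z1 then 1 else 0) * c z1 r * (5 * ind r))
      + ∑ y, 5 * w y r := by
    intro r
    simp only [split]
    rw [sum_add_distrib]
    refine add_le_add ?_ ?_
    · rw [sum_comm]
      refine sum_le_sum fun q1 _ => ?_
      rw [sum_comm]
      exact sum_le_sum fun z1 _ => key1 q1 z1 r
    · refine sum_le_sum fun y _ => ?_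
      dsimp only [w]
      rw [mul_sum]
      refine sum_le_sum fun q1 _ => ?_
      rw [mul_sum]
      refine sum_le_sum fun z1 _ => ?_
      rw [mul_comm 5]
      exact key2 q1 z1 r y
  have w0 : ∀ y r, 0 ≤ w y r := fun y r =>
    sum_nonneg fun q _ => sum_nonneg fun z _ => mul_nonneg (b0 _ _ _) (c0 _ _)
  have sm2 : ∀ r, ∑ y, (w y r) ^ 2 / om r ≤
      (∑ q1, ∑ z1, (if I q1 z1 then 1 else 0) * c z1 r * 5)
      + ∑ y, 5 / d * w y r := by
    intro r
    rw [← sum_div, div_le_iff₀ (om0 r), add_mul]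
    refine (sm r).trans (add_le_add ?_ ?_)
    · rw [sum_mul]
      refine sum_le_sum fun q1 _ => ?_
      rw [sum_mul]
      refine sum_le_sum fun z1 _ => ?_
      rw [mul_assoc _ (5:ℝ)]
      refine mul_le_mul_of_nonneg_left ?_ (mul_nonneg (by split_ifs <;> norm_num) (c0 _ _))
      dsimp only [om]; linarith
    · rw [sum_mul]
      refine sum_le_sum fun y _ => ?_
      have h := ind0 r
      have := w0 y r
      have : 5 / d * w y r * om r = 5 * w y r + 5 / d * w y r * ind r := by
        dsimp only [om]; field_simp; ring
      rw [this]
      have : 0 ≤ 5 / d * w y r * ind r := by positivity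
      linarith
  have tot : ∑ y, ∑ r, (w y r) ^ 2 / om r ≤ 5 * d * M + 5 * T := by
    rw [sum_comm]
    refine (sum_le_sum fun r _ => sm2 r).trans ?_
    rw [sum_add_distrib]
    refine add_le_add ?_ ?_
    · rw [sum_comm, hM, mul_sum]
      refine sum_le_sum fun q1 _ => ?_
      rw [sum_comm, mul_sum]
      refine sum_le_sum fun z1 _ => ?_
      rw [← sum_mul, ← mul_sum, csum]
      have : ((N z1).card : ℝ) ≤ d := by exact_mod_cast hN z1
      split_ifs <;> linarith
    · rw [sum_comm]
      simp only [← mul_sum]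
      rw [wsum]
      field_simp
      rfl
  have n0 : 0 ≤ n := by positivity
  have T0 : 0 ≤ T := by
    rw [hT]; exact sum_nonneg fun q _ => sum_nonneg fun y _ => sum_nonneg fun z _ => b0 q y z
  have M0 : 0 ≤ M := by
    rw [hM]; exact sum_nonneg fun q _ => sum_nonneg fun y _ => by split_ifs <;> norm_num
  have fin : (d * T) ^ 2 ≤ (5 * d * M + 5 * T) * (n * (2 * n * d)) :=
    cs.trans (mul_le_mul tot (mul_le_mul_of_nonneg_left omsum n0)
      (mul_nonneg n0 (sum_nonneg fun r _ => (om0 r).le)) (by positivity))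
  have : d * (d * T ^ 2) ≤ d * (10 * n ^ 2 * (d * M + T)) := by nlinarith
  exact le_of_mul_le_mul_left this hd'

set_option maxHeartbeats 4000000 in
theorem core {V : Type} [Fintype V] (H : SimpleGraph V) (P : Finset (V × V))
    (hcr : ∀ e ∈ H.edgeSet, ∃ q ∈ P, ∃ a b, e = s(a, b) ∧ Crit H q.1 q.2 a b)
    (m n p : ℝ) (hm : m = H.edgeSet.ncard) (hn : n = Fintype.card V) (hp : p = P.card) :
    m ≤ 2 * n ∨ m ≤ 4 * p ∨ m ^ 3 ≤ 2560 * n ^ 2 * p ^ 2 ∨ m ^ 3 ≤ 1280 * n ^ 3 * p := by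
  classical
  have hcr' : ∀ e : H.edgeSet, ∃ x : P × V × V, e.1 = s(x.2.1, x.2.2) ∧
      Crit H x.1.1.1 x.1.1.2 x.2.1 x.2.2 := by
    rintro ⟨e, he⟩
    obtain ⟨q, hq, a, b, h1, h2⟩ := hcr e he
    exact ⟨⟨⟨q, hq⟩, a, b⟩, h1, h2⟩
  choose F hFe hFc using hcr'
  set m' := H.edgeSet.ncard with hm'
  set n' := Fintype.card V with hn'
  have hmc : Fintype.card H.edgeSet = m' := by
    rw [hm', Set.ncard_eq_toFinset_card', Set.toFinset_card]
  set d := m' / (2 * n') with hd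
  by_cases hd0 : d = 0
  · left
    rw [hm, hn]
    by_cases hn0 : n' = 0
    · have : IsEmpty V := Fintype.card_eq_zero_iff.1 hn0
      have : m' = 0 := by
        rw [← hmc, Fintype.card_eq_zero_iff]
        exact ⟨fun e => this.elim (F e).2.1⟩
      rw [this]; simp
    · have := (Nat.div_eq_zero_iff).1 hd0
      have : m' ≤ 2 * n' := by omega
      exact_mod_cast this
  right
  have hdpos : 0 < d := Nat.pos_of_ne_zero hd0
  have hn0 : 0 < n' := by
    rcases Nat.eq_zero_or_pos n' with h | h
    · exfalso; apply hd0; rw [hd, h]; simp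
    · exact h
  have hdm : 2 * (n' * d) ≤ m' := by
    have := Nat.mul_div_le m' (2 * n')
    rw [← hd] at this
    linarith
  have hmd : m' ≤ 4 * n' * d := by
    have := Nat.lt_mul_div_succ m' (show 0 < 2 * n' by omega)
    rw [← hd] at this
    nlinarith
  have hNex : ∀ z, ∃ s : Finset V, s ⊆ H.neighborFinset z ∧ s.card ≤ d ∧
      (d ≤ H.degree z → s.card = d) := by
    intro z
    by_cases h : d ≤ H.degree z
    · obtain ⟨s, hs, hc⟩ := Finset.exists_subset_card_eq h
      exact ⟨s, hs, hc.le, fun _ => hc⟩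
    · exact ⟨∅, by simp, by simp, fun h' => absurd h' h⟩
  choose N hNsub hNle hNeq using hNex
  let I : P → V → Prop := fun q z => d ≤ H.degree z ∧ ∃ e, (F e).1 = q ∧ (F e).2.1 = z
  let pos : P → V → ℕ := fun q z => H.dist q.1.1 z
  let B : P → V → V → Prop := fun q y z => I q y ∧ I q z ∧ pos q y < pos q z
  -- unpacking incidences
  have hI : ∀ q z, I q z → ∃ b, Crit H q.1.1 q.1.2 z b ∧
      ∃ e, (F e).1 = q ∧ (F e).2.1 = z ∧ (F e).2.2 = b := by
    rintro q z ⟨_, e, rfl, rfl⟩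
    exact ⟨_, hFc e, e, rfl, rfl, rfl⟩
  have hown : ∀ q q' y b, (∃ e, (F e).1 = q ∧ (F e).2.1 = y ∧ (F e).2.2 = b) →
      (∃ e, (F e).1 = q' ∧ (F e).2.1 = y ∧ (F e).2.2 = b) → q = q' := by
    rintro q q' y b ⟨e, rfl, h1, h2⟩ ⟨e', rfl, h3, h4⟩
    have : e = e' := by
      apply Subtype.ext
      rw [hFe e, hFe e', h1, h2, h3, h4]
    rw [this]
  have posinj : ∀ q y z, I q y → I q z → pos q y = pos q z → y = z := by
    intro q y z hy hz h
    obtain ⟨b, hb, _⟩ := hI q y hy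
    obtain ⟨b', hb', _⟩ := hI q z hz
    exact (hb.inj hb' h).1.symm
  have near : ∀ z1 z2 r, r ∈ N z1 → r ∈ N z2 → H.Reachable z1 z2 ∧ H.dist z1 z2 ≤ 2 := by
    intro z1 z2 r h1 h2
    have a1 : H.Adj z1 r := by simpa using hNsub z1 h1
    have a2 : H.Adj z2 r := by simpa using hNsub z2 h2
    have := tri a1.reachable a2.symm.reachable
    have := adj_le a1
    have := adj_le a2.symm
    exact ⟨a1.reachable.trans a2.symm.reachable, by omega⟩
  have h2 : ∀ q z1 r y, B q y z1 → r ∈ N z1 →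
      ((Finset.univ : Finset V).filter (fun z2 => B q y z2 ∧ r ∈ N z2)).card ≤ 5 := by
    intro q z1 r y hB hr
    have := Finset.card_le_card_of_injOn
      (s := (Finset.univ : Finset V).filter (fun z2 => B q y z2 ∧ r ∈ N z2))
      (t := Finset.range 5) (fun z2 => pos q z2 + 2 - pos q z1) ?_ ?_
    · simpa using this
    · intro z2 hz2
      obtain ⟨hB2, hr2⟩ := (Finset.mem_filter.1 hz2).2
      obtain ⟨b1, c1, _⟩ := hI q z1 hB.2.1
      have hn := near z1 z2 r hr hr2
      have := tri c1.ra hn.1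
      simp only [Finset.coe_range, Set.mem_Iio, pos]
      omega
    · intro z2 hz2 z3 hz3 h
      obtain ⟨hB2, hr2⟩ := (Finset.mem_filter.1 hz2).2
      obtain ⟨hB3, hr3⟩ := (Finset.mem_filter.1 hz3).2
      apply posinj q _ _ hB2.2.1 hB3.2.1
      obtain ⟨b2, c2, _⟩ := hI q z2 hB2.2.1
      obtain ⟨b3, c3, _⟩ := hI q z3 hB3.2.1
      have t2 := near z2 z1 r hr2 hr
      have t3 := near z3 z1 r hr3 hr
      have := tri c2.ra t2.1
      have := tri c3.ra t3.1
      simp only [pos] at *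
      omega
  have h1 : ∀ q1 z1 z2 r, I q1 z1 → r ∈ N z1 → r ∈ N z2 →
      ((Finset.univ : Finset (V × P)).filter
        (fun x => x.2 ≠ q1 ∧ B q1 x.1 z1 ∧ B x.2 x.1 z2)).card ≤ 5 := by
    intro q1 z1 z2 r hI1 hr1 hr2
    obtain ⟨b1, c1, _⟩ := hI q1 z1 hI1
    have hn := near z1 z2 r hr1 hr2
    -- the range of the potential
    have rng : ∀ y, B q1 y z1 → pos q1 z1 ≤ H.dist y z2 + pos q1 y + 2 ∧
        H.dist y z2 + pos q1 y ≤ pos q1 z1 + 2 := by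
      intro y hB
      obtain ⟨b, c, _⟩ := hI q1 y hB.1
      have e := (c.between c1.ra c1.on hB.2.2).2
      have yz1 : H.Reachable y z1 := c.ra.symm.trans c1.ra
      have t1 := tri yz1 hn.1
      have t2 := tri (yz1.trans hn.1) hn.1.symm
      rw [dist_comm (u := z2)] at t2
      simp only [pos] at *
      omega
    -- strict monotonicity of the potential
    have mono : ∀ y y' q2, q2 ≠ q1 → B q1 y z1 → B q2 y z2 → B q1 y' z1 →
        pos q1 y < pos q1 y' → H.dist y z2 + pos q1 y < H.dist y' z2 + pos q1 y' := by
      intro y y' q2 hne hB hB2 hB' hlt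
      obtain ⟨b, c, o⟩ := hI q1 y hB.1
      obtain ⟨b', c', _⟩ := hI q1 y' hB'.1
      obtain ⟨b2, c2, o2⟩ := hI q2 y hB2.1
      obtain ⟨b3, c3, _⟩ := hI q2 z2 hB2.2.1
      by_contra hcon
      obtain ⟨e1, e2⟩ := c.between c'.ra c'.on hlt
      have yz : H.Reachable y' z2 := (c'.ra.symm.trans c1.ra).trans hn.1
      have by' : H.Reachable b y' := c.adj.symm.reachable.trans (c.ra.symm.trans c'.ra)
      have t1 := tri by' yz
      have : b = b2 := c2.first c3.ra c3.on hB2.2.2 c.adj (by simp only [pos] at *; omega)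
      subst this
      exact hne (hown _ _ _ _ o2 o)
    have := Finset.card_le_card_of_injOn
      (s := (Finset.univ : Finset (V × P)).filter
        (fun x => x.2 ≠ q1 ∧ B q1 x.1 z1 ∧ B x.2 x.1 z2))
      (t := Finset.range 5) (fun x => H.dist x.1 z2 + pos q1 x.1 + 2 - pos q1 z1) ?_ ?_
    · simpa using this
    · rintro ⟨y, q2⟩ hx
      obtain ⟨hne, hB, hB2⟩ := (Finset.mem_filter.1 hx).2
      have := rng y hB
      simp only [Finset.coe_range, Set.mem_Iio]
      omega
    · rintro ⟨y, q2⟩ hx ⟨y', q3⟩ hx' h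
      obtain ⟨hne, hB, hB2⟩ := (Finset.mem_filter.1 hx).2
      obtain ⟨hne', hB', hB2'⟩ := (Finset.mem_filter.1 hx').2
      dsimp only at hne hB hB2 hne' hB' hB2' h
      have r1 := rng y hB
      have r2 := rng y' hB'
      have hyy : y = y' := by
        apply posinj q1 _ _ hB.1 hB'.1
        rcases lt_trichotomy (pos q1 y) (pos q1 y') with hl | hl | hl
        · have := mono y y' q2 hne hB hB2 hB' hl
          omega
        · exact hl
        · have := mono y' y q3 hne' hB' hB2' hB hl
          omega
      subst hyy
      obtain ⟨b2, c2, o2⟩ := hI q2 y hB2.1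
      obtain ⟨b3, c3, o3⟩ := hI q3 y hB2'.1
      obtain ⟨_, cz2, _⟩ := hI q2 z2 hB2.2.1
      obtain ⟨_, cz3, _⟩ := hI q3 z2 hB2'.2.1
      have e := (c2.between cz2.ra cz2.on hB2.2.2).1
      have : b2 = b3 := c3.first cz3.ra cz3.on hB2'.2.2 c2.adj (by omega)
      subst this
      rw [hown _ _ _ _ o2 o3]
  set T : ℝ := ∑ q, ∑ y, ∑ z, if B q y z then (1:ℝ) else 0 with hT
  set M : ℝ := ∑ q, ∑ z, if I q z then (1:ℝ) else 0 with hM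
  have main := counting B I N d hdpos (fun q y z h => h.2.1) hNle
    (fun q z h => hNeq z h.1) h1 h2 T M hT hM
  -- lower bound on M
  have hMm : (m' : ℝ) ≤ 2 * M := by
    let hi := (Finset.univ : Finset H.edgeSet).filter (fun e => d ≤ H.degree (F e).2.1)
    let lo := (Finset.univ : Finset H.edgeSet).filter (fun e => ¬ d ≤ H.degree (F e).2.1)
    have hsum : hi.card + lo.card = m' := by
      rw [← hmc]
      exact Finset.card_filter_add_card_filter_not _
    have hhi : hi.card ≤ ((Finset.univ : Finset (P × V)).filter (fun x => I x.1 x.2)).card := by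
      refine Finset.card_le_card_of_injOn (fun e => ((F e).1, (F e).2.1)) ?_ ?_
      · intro e he
        have := (Finset.mem_filter.1 he).2
        simp only [Finset.coe_filter, Finset.mem_univ, true_and, Set.mem_setOf_eq]
        exact ⟨this, e, rfl, rfl⟩
      · intro e _ e' _ h
        obtain ⟨hq, ha⟩ := Prod.mk.inj h
        have ce := hFc e
        have ce' := hFc e'
        rw [← hq, ← ha] at ce'
        have hb := (ce.inj ce' rfl).2
        apply Subtype.ext
        rw [hFe e, hFe e', ← ha, hb]
    have hlo : lo.card ≤ n' * d := by
      have h1 : lo.card ≤ ((Finset.univ.filter (fun a => ¬ d ≤ H.degree a)).sigma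
          (fun a => H.neighborFinset a)).card := by
        refine Finset.card_le_card_of_injOn (fun e => (⟨(F e).2.1, (F e).2.2⟩ : (_ : V) × V)) ?_ ?_
        · intro e he
          have := (Finset.mem_filter.1 he).2
          simp only [Finset.mem_coe, Finset.mem_sigma, Finset.mem_filter, Finset.mem_univ,
            true_and, mem_neighborFinset]
          exact ⟨this, (hFc e).adj⟩
        · intro e _ e' _ h
          have ha : (F e).2.1 = (F e').2.1 := congrArg Sigma.fst h
          have hb : (F e).2.2 = (F e').2.2 := congrArg (fun x : (_ : V) × V => x.2) h
          apply Subtype.ext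
          rw [hFe e, hFe e', ha, hb]
      rw [Finset.card_sigma] at h1
      have h2 : ∑ a ∈ Finset.univ.filter (fun a => ¬ d ≤ H.degree a), (H.neighborFinset a).card
          ≤ (Finset.univ.filter (fun a => ¬ d ≤ H.degree a)).card * d := by
        rw [← smul_eq_mul]
        refine Finset.sum_le_card_nsmul _ _ _ fun a ha => ?_
        have := (Finset.mem_filter.1 ha).2
        rw [card_neighborFinset_eq_degree]
        omega
      have h3 : (Finset.univ.filter (fun a => ¬ d ≤ H.degree a)).card ≤ n' :=
        Finset.card_le_univ _
      exact h1.trans (h2.trans (Nat.mul_le_mul_right d h3))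
    have hMc : M = (((Finset.univ : Finset (P × V)).filter (fun x => I x.1 x.2)).card : ℝ) := by
      rw [hM, ← Finset.sum_product', Finset.univ_product_univ, Finset.sum_boole]
    rw [hMc]
    exact_mod_cast (by omega : m' ≤ 2 * _)
  have hMT : M ^ 2 ≤ p * (2 * T + M) := by
    let l : P → ℝ := fun q => ∑ z, if I q z then (1:ℝ) else 0
    have hl : ∀ q, l q ^ 2 ≤ 2 * (∑ y, ∑ z, if B q y z then (1:ℝ) else 0) + l q := by
      intro q
      have e1 : l q ^ 2 = ∑ y, ∑ z, (if I q y then (1:ℝ) else 0) * (if I q z then 1 else 0) := by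
        rw [sq, Finset.sum_mul_sum]
      have e2 : l q = ∑ y, ∑ z, if y = z then (if I q y then (1:ℝ) else 0) else 0 := by
        simp [l]
      have e3 : 2 * (∑ y, ∑ z, if B q y z then (1:ℝ) else 0) =
          (∑ y, ∑ z, if B q y z then (1:ℝ) else 0) + ∑ y, ∑ z, if B q z y then (1:ℝ) else 0 := by
        rw [two_mul]; congr 1; rw [Finset.sum_comm]
      rw [e1, e3, e2, ← Finset.sum_add_distrib, ← Finset.sum_add_distrib]
      refine Finset.sum_le_sum fun y _ => ?_
      rw [← Finset.sum_add_distrib, ← Finset.sum_add_distrib]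
      refine Finset.sum_le_sum fun z _ => ?_
      by_cases hy : I q y
      swap
      · simp only [hy, if_false, zero_mul]; split_ifs <;> norm_num
      by_cases hz : I q z
      swap
      · simp only [hz, if_false, mul_zero]; split_ifs <;> norm_num
      rcases lt_trichotomy (pos q y) (pos q z) with h | h | h
      · have : B q y z := ⟨hy, hz, h⟩
        simp only [this, hy, hz, if_true]; split_ifs <;> norm_num
      · have := posinj q y z hy hz h
        subst this
        simp only [hy, if_true]; split_ifs <;> norm_num
      · have : B q z y := ⟨hz, hy, h⟩
        simp only [this, hy, hz, if_true]; split_ifs <;> norm_num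
    have c := sq_sum_le_card_mul_sum_sq (s := (Finset.univ : Finset P)) (f := l)
    have hcard : ((Finset.univ : Finset P).card : ℝ) = p := by
      rw [hp, Finset.card_univ, Fintype.card_coe]
    rw [hcard] at c
    refine c.trans (mul_le_mul_of_nonneg_left ?_ (by rw [hp]; positivity))
    refine (Finset.sum_le_sum fun q _ => hl q).trans ?_
    rw [Finset.sum_add_distrib, ← Finset.mul_sum]
  have T0 : 0 ≤ T := Finset.sum_nonneg fun q _ => Finset.sum_nonneg fun y _ =>
    Finset.sum_nonneg fun z _ => by split_ifs <;> norm_num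
  have hmdR : m ≤ 4 * n * d := by rw [hm, hn]; exact_mod_cast hmd
  have hdR : (0:ℝ) < d := by exact_mod_cast hdpos
  rw [← hm] at hMm
  rw [← hn] at main
  have m0 : 0 ≤ m := by rw [hm]; positivity
  have p0 : 0 ≤ p := by rw [hp]; positivity
  have n0 : 0 < n := by rw [hn]; exact_mod_cast hn0
  clear_value T M d
  clear * - main hMm hMT T0 hmdR hdR m0 p0 n0
  by_cases hMp : M < 2 * p
  · left; linarith
  right
  have M0 : 0 ≤ M := by linarith
  have hM4 : M ^ 2 ≤ 4 * p * T := by nlinarith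
  rcases M0.eq_or_lt with hM0 | hMpos
  · left
    have : m = 0 := by linarith
    have h0 : (0:ℝ) ^ 3 = 0 := by norm_num
    rw [this, h0]; positivity
  rcases le_total T (d * M) with hc | hc
  · left
    have h1 : T ^ 2 ≤ 20 * n ^ 2 * M := by
      have : d * T ^ 2 ≤ d * (20 * n ^ 2 * M) := by nlinarith [sq_nonneg n]
      exact le_of_mul_le_mul_left this hdR
    have h2 : M ^ 2 * M ^ 2 ≤ (4 * p * T) * (4 * p * T) :=
      mul_le_mul hM4 hM4 (by positivity) (by positivity)
    have h3 : M * M ^ 3 ≤ M * (320 * n ^ 2 * p ^ 2) := by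
      have : p ^ 2 * T ^ 2 ≤ p ^ 2 * (20 * n ^ 2 * M) := mul_le_mul_of_nonneg_left h1 (sq_nonneg p)
      nlinarith
    have h4 := le_of_mul_le_mul_left h3 hMpos
    have h5 : m ^ 3 ≤ (2 * M) ^ 3 := pow_le_pow_left₀ m0 hMm 3
    nlinarith
  · right
    have Tpos : 0 < T := lt_of_lt_of_le (by positivity) hc
    have h1 : d * T ≤ 20 * n ^ 2 := by
      have : T * (d * T) ≤ T * (20 * n ^ 2) := by nlinarith [sq_nonneg n]
      exact le_of_mul_le_mul_left this Tpos
    have h2 : m * M ^ 2 ≤ (4 * n * d) * (4 * p * T) :=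
      mul_le_mul hmdR hM4 (by positivity) (by positivity)
    have h3 : (n * p) * (d * T) ≤ (n * p) * (20 * n ^ 2) :=
      mul_le_mul_of_nonneg_left h1 (by positivity)
    have h4 : m ^ 2 ≤ (2 * M) ^ 2 := pow_le_pow_left₀ m0 hMm 2
    have h5 : m * m ^ 2 ≤ m * (2 * M) ^ 2 := mul_le_mul_of_nonneg_left h4 m0
    nlinarith

theorem exists_min {V : Type} [Fintype V] (G : SimpleGraph V) (P : Finset (V × V))
    (hP : ∀ p ∈ P, G.Reachable p.1 p.2) :
    ∃ H : SimpleGraph V, H ≤ G ∧ (∀ p ∈ P, H.dist p.1 p.2 = G.dist p.1 p.2) ∧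
      ∀ e ∈ H.edgeSet, ∃ q ∈ P, ∃ a b, e = s(a, b) ∧ Crit H q.1 q.2 a b := by
  classical
  let S : Set (SimpleGraph V) := {H | H ≤ G ∧
    ∀ p ∈ P, H.Reachable p.1 p.2 ∧ H.dist p.1 p.2 = G.dist p.1 p.2}
  have hS : S.Nonempty := ⟨G, le_rfl, fun p hp => ⟨hP p hp, rfl⟩⟩
  obtain ⟨H, hH, hmin⟩ := Set.exists_min_image S (fun H => H.edgeSet.ncard) (Set.toFinite _) hS
  refine ⟨H, hH.1, fun p hp => (hH.2 p hp).2, fun e he => ?_⟩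
  have hle : H.deleteEdges {e} ≤ H := deleteEdges_le _
  have hnot : H.deleteEdges {e} ∉ S := by
    intro hmem
    have h1 := hmin _ hmem
    have h2 : (H.deleteEdges {e}).edgeSet.ncard < H.edgeSet.ncard := by
      rw [edgeSet_deleteEdges]
      exact Set.ncard_diff_singleton_lt_of_mem he (Set.toFinite _)
    omega
  by_contra hcon
  push Not at hcon
  apply hnot
  refine ⟨hle.trans hH.1, fun q hq => ?_⟩
  obtain ⟨hr, hd⟩ := hH.2 q hq
  obtain ⟨w, hw, hew⟩ : ∃ w : H.Walk q.1 q.2, w.length = H.dist q.1 q.2 ∧ e ∉ w.edges := by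
    by_contra hno
    push Not at hno
    obtain ⟨a, b, h1, h2⟩ := exists_crit e hr hno
    exact hcon q hq a b h1 h2
  have w' := w.toDeleteEdge e hew
  have hwl : (w.toDeleteEdge e hew).length = w.length := by simp
  have hr' : (H.deleteEdges {e}).Reachable q.1 q.2 := ⟨w'⟩
  refine ⟨hr', ?_⟩
  have h1 := dist_le (w.toDeleteEdge e hew)
  have h2 := hr'.dist_anti hle
  omega

end SDP

/-- **Sparser distance preservers.** There is an absolute constant `C` such that for every
undirected unweighted graph `G` on `n` vertices and every pair set `P ⊆ V × V` in which every
pair lies in the same connected component, there is a subgraph `H` of `G` that is a pairwise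
distance preserver of `(G, P)` with at most `C · (n^(2/3) |P|^(2/3) + n |P|^(1/3))` edges. -/
theorem sparser_distance_preservers :
    ∃ C : ℝ, 0 < C ∧
      ∀ (V : Type) [Fintype V] (G : SimpleGraph V) (P : Finset (V × V)),
        (∀ p ∈ P, G.Reachable p.1 p.2) →
        ∃ H : SimpleGraph V, H ≤ G ∧
          (∀ p ∈ P, H.dist p.1 p.2 = G.dist p.1 p.2) ∧
          (H.edgeSet.ncard : ℝ) ≤
            C * ((Fintype.card V : ℝ) ^ ((2 : ℝ) / 3) * (P.card : ℝ) ^ ((2 : ℝ) / 3)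
              + (Fintype.card V : ℝ) * (P.card : ℝ) ^ ((1 : ℝ) / 3)) := by
  refine ⟨14, by norm_num, ?_⟩
  intro V _ G P hP
  obtain ⟨H, hHG, hHd, hcr⟩ := SDP.exists_min G P hP
  refine ⟨H, hHG, hHd, ?_⟩
  have core := SDP.core H P hcr _ _ _ rfl rfl rfl
  have n0 : (0:ℝ) ≤ (Fintype.card V : ℝ) := by positivity
  have p0 : (0:ℝ) ≤ (P.card : ℝ) := by positivity
  have m0 : (0:ℝ) ≤ (H.edgeSet.ncard : ℝ) := by positivity
  have hzero : P.card = 0 → (H.edgeSet.ncard : ℝ) = 0 := by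
    intro h
    have hPe : P = ∅ := Finset.card_eq_zero.1 h
    have : H.edgeSet = ∅ := by
      rw [Set.eq_empty_iff_forall_notMem]
      intro e he
      obtain ⟨q, hq, _⟩ := hcr e he
      simp [hPe] at hq
    rw [this]; simp
  have hpn : (P.card : ℝ) ≤ (Fintype.card V : ℝ) ^ 2 := by
    have : P.card ≤ Fintype.card (V × V) := Finset.card_le_univ _
    rw [Fintype.card_prod] at this
    rw [sq]
    exact_mod_cast this
  have hp1 : P.card = 0 ∨ (1:ℝ) ≤ (P.card : ℝ) := by
    rcases Nat.eq_zero_or_pos P.card with h | h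
    · exact Or.inl h
    · right; exact_mod_cast h
  generalize (H.edgeSet.ncard : ℝ) = m at *
  have key : ∀ t : ℝ, 0 ≤ t → (t ^ ((1:ℝ)/3)) ^ 3 = t ∧ t ^ ((2:ℝ)/3) = (t ^ ((1:ℝ)/3)) ^ 2 := by
    intro t ht
    constructor
    · rw [← Real.rpow_natCast, ← Real.rpow_mul ht]; norm_num
    · rw [← Real.rpow_natCast, ← Real.rpow_mul ht]; norm_num
  obtain ⟨hx3, hx2⟩ := key _ n0
  obtain ⟨hy3, hy2⟩ := key _ p0
  have x0 : 0 ≤ (Fintype.card V : ℝ) ^ ((1:ℝ)/3) := Real.rpow_nonneg n0 _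
  have y0 : 0 ≤ (P.card : ℝ) ^ ((1:ℝ)/3) := Real.rpow_nonneg p0 _
  rw [hx2, hy2]
  generalize (Fintype.card V : ℝ) ^ ((1:ℝ)/3) = x at *
  generalize (P.card : ℝ) ^ ((1:ℝ)/3) = y at *
  rw [← hx3] at core hpn ⊢
  rw [← hy3] at core hpn hp1
  have a0 : 0 ≤ x ^ 2 * y ^ 2 := by positivity
  have a1 : 0 ≤ x ^ 3 * y := by positivity
  rcases hp1 with h | h
  · rw [hzero h]; positivity
  have hy1 : 1 ≤ y := by
    by_contra hlt
    push Not at hlt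
    have : y ^ 3 < 1 := pow_lt_one₀ y0 hlt (by norm_num)
    linarith
  have hyx : y ≤ x ^ 2 := by
    apply le_of_pow_le_pow_left₀ (n := 3) (by norm_num) (by positivity)
    calc y ^ 3 ≤ (x ^ 3) ^ 2 := hpn
      _ = (x ^ 2) ^ 3 := by ring
  rcases core with h | h | h | h
  · have : x ^ 3 * 1 ≤ x ^ 3 * y := mul_le_mul_of_nonneg_left hy1 (by positivity)
    linarith
  · have : y ^ 2 * y ≤ y ^ 2 * x ^ 2 := mul_le_mul_of_nonneg_left hyx (by positivity)
    have e : y ^ 3 = y ^ 2 * y := by ring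
    rw [e] at h
    linarith
  · have : m ≤ 14 * (x ^ 2 * y ^ 2) := by
      apply le_of_pow_le_pow_left₀ (n := 3) (by norm_num) (by positivity)
      have : 0 ≤ (x ^ 2 * y ^ 2) ^ 3 := by positivity
      nlinarith
    linarith
  · have : m ≤ 14 * (x ^ 3 * y) := by
      apply le_of_pow_le_pow_left₀ (n := 3) (by norm_num) (by positivity)
      have : 0 ≤ (x ^ 3 * y) ^ 3 := by positivity
      nlinarith
    linarith
end

section
/- There is an absolute constant C such that for every undirected unweighted graph G on n vertices, every pair set P ⊆ V×V of pairs of vertices in the same connected component, and every consistent path tiebreaking scheme ρ_G on G, the subgraph H = ∪_{p∈P} ρ_G(p) has at most C·(n + n^{1/2}·|P|) edges. -/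
/-- Every `ρ u v h` is a shortest path from `u` to `v`. -/
def IsShortestPathScheme {V : Type*} {G : SimpleGraph V}
    (ρ : ∀ u v : V, G.Reachable u v → G.Walk u v) : Prop :=
  ∀ (u v : V) (h : G.Reachable u v), (ρ u v h).IsPath ∧ (ρ u v h).length = G.dist u v

/-- A path tiebreaking scheme is consistent if whenever `w` and `x` both lie on `ρ u v`
(with `x` not before `w`), the path `ρ w x` equals the subpath of `ρ u v` between `w`
and `x`. -/
def IsConsistentScheme {V : Type*} [DecidableEq V] {G : SimpleGraph V}
    (ρ : ∀ u v : V, G.Reachable u v → G.Walk u v) : Prop :=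
  ∀ (u v : V) (h : G.Reachable u v) (w : V) (hw : w ∈ (ρ u v h).support)
    (x : V) (hx : x ∈ ((ρ u v h).dropUntil w hw).support) (h' : G.Reachable w x),
    ρ w x h' = ((ρ u v h).dropUntil w hw).takeUntil x hx

section abs
open Finset
variable {V ι : Type} [Fintype V] [DecidableEq V]

def MeetAt (S : ι → V → Prop) (pos : ι → V → ℕ) (v : V) (p q : ι) : Prop :=
  ∃ a, S p a ∧ S q a ∧ pos p a < pos p v ∧ pos q v < pos q a

def AntiAt (S : ι → V → Prop) (pos : ι → V → ℕ) (v : V) (p q : ι) : Prop :=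
  MeetAt S pos v p q ∧ MeetAt S pos v q p

structure Sys (d : V → V → ℕ) (S : ι → V → Prop) (pos : ι → V → ℕ) (A : ι → V → V → Prop) : Prop where
  d0 : ∀ a b, (∃ q, S q a ∧ S q b) → d a b = 0 → a = b
  ds : ∀ a b, d a b = d b a
  dt : ∀ a b c, (∃ q, S q a ∧ S q b) → (∃ q, S q b ∧ S q c) → d a c ≤ d a b + d b c
  h1 : ∀ q a b, S q a → S q b → pos q a ≤ pos q b → d a b + pos q a = pos q b
  h2 : ∀ p q a b x y, S p a → S q a → S p b → S q b → pos p a < pos p b → pos q a < pos q b →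
    A p x b → A q y b → x = y
  h4 : ∀ q x y v, A q x v → A q y v → x = y
  hA : ∀ q x v, A q x v → S q v

variable {d : V → V → ℕ} {S : ι → V → Prop} {pos : ι → V → ℕ} {A : ι → V → V → Prop}

lemma Sys.key (h : Sys d S pos A) {v : V} {p q r : ι} {a a' c : V}
    (vp : S p v) (vq : S q v) (vr : S r v)
    (h1 : S p a ∧ S q a ∧ pos p a < pos p v ∧ pos q v < pos q a)
    (h2 : S p a' ∧ S r a' ∧ pos p a' < pos p v ∧ pos r v < pos r a')
    (h3 : S q c ∧ S r c ∧ pos q c < pos q v ∧ pos r v < pos r c) :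
    d v a + d v c ≤ d v a' := by
  have e1 := h.h1 p a v h1.1 vp h1.2.2.1.le
  have e2 := h.h1 q v a vq h1.2.1 h1.2.2.2.le
  have e3 := h.h1 p a' v h2.1 vp h2.2.2.1.le
  have e4 := h.h1 r v a' vr h2.2.1 h2.2.2.2.le
  have e5 := h.h1 q c v h3.1 vq h3.2.2.1.le
  have e6 := h.h1 r v c vr h3.2.1 h3.2.2.2.le
  have e7 := h.h1 q c a h3.1 h1.2.1 (by omega)
  have t := h.dt c a' a ⟨r, h3.2.1, h2.2.1⟩ ⟨p, h2.1, h1.1⟩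
  have s1 := h.ds a v
  have s2 := h.ds a' v
  have s3 := h.ds c v
  have s4 := h.ds a' a
  have s5 := h.ds c a'
  rcases le_total (pos p a) (pos p a') with k | k <;> rcases le_total (pos r c) (pos r a') with l | l
  all_goals
    first
    | have e8 := h.h1 p a a' h1.1 h2.1 k
    | have e8 := h.h1 p a' a h2.1 h1.1 k
    first
    | have e9 := h.h1 r c a' h3.2.1 h2.2.1 l
    | have e9 := h.h1 r a' c h2.2.1 h3.2.1 l
    omega

lemma Sys.no_triangle (h : Sys d S pos A) {v : V} {p q r : ι}
    (vp : S p v) (vq : S q v) (vr : S r v)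
    (h1 : AntiAt S pos v p q) (h2 : AntiAt S pos v q r) (h3 : AntiAt S pos v p r) : False := by
  obtain ⟨⟨a, ha⟩, -⟩ := h1
  obtain ⟨⟨b, hb⟩, ⟨c, hc⟩⟩ := h2
  obtain ⟨⟨e, he⟩, -⟩ := h3
  have k1 := h.key vp vq vr ha he hb
  have k2 := h.key vp vr vq he ha hc
  have := h.h1 r c v hc.1 vr hc.2.2.1.le
  have := h.ds c v
  omega

def BadAt (S : ι → V → Prop) (pos : ι → V → ℕ) (A : ι → V → V → Prop) (v : V) (p q : ι) : Prop :=
  ∃ x y, x ≠ y ∧ A p x v ∧ A q y v ∧ ¬ AntiAt S pos v p q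

lemma Sys.sorted (h : Sys d S pos A) {p q : ι} {u v w : V}
    (hu : BadAt S pos A u p q) (hv : BadAt S pos A v p q) (hw : BadAt S pos A w p q)
    (k1 : pos p u < pos p v) (k2 : pos p v < pos p w) : False := by
  obtain ⟨x1, y1, n1, a1, b1, -⟩ := hu
  obtain ⟨x2, y2, n2, a2, b2, c⟩ := hv
  obtain ⟨x3, y3, n3, a3, b3, -⟩ := hw
  have su := h.hA _ _ _ a1
  have sv := h.hA _ _ _ a2
  have sw := h.hA _ _ _ a3
  have tu := h.hA _ _ _ b1
  have tv := h.hA _ _ _ b2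
  have tw := h.hA _ _ _ b3
  have l1 : ¬ pos q u < pos q v := fun l => n2 (h.h2 p q u v _ _ su tu sv tv k1 l a2 b2)
  have l2 : ¬ pos q v < pos q w := fun l => n3 (h.h2 p q v w _ _ sv tv sw tw k2 l a3 b3)
  have d1 := h.h1 p u v su sv k1.le
  have d2 := h.h1 p v w sv sw k2.le
  have d3 := h.h1 q v u tv tu (by omega)
  have d4 := h.h1 q w v tw tv (by omega)
  have := h.ds u v
  have := h.ds w v
  exact c ⟨⟨u, su, tu, k1, by omega⟩, ⟨w, tw, sw, by omega, k2⟩⟩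

open Classical in
lemma Sys.bad_card (h : Sys d S pos A) (p q : ι) :
    #{v : V | BadAt S pos A v p q} ≤ 2 := by
  by_contra hc
  obtain ⟨u, hu, v, hv, w, hw, n1, n2, n3⟩ := Finset.two_lt_card.1 (not_le.1 hc)
  simp only [mem_filter, mem_univ, true_and] at hu hv hw
  have inj : ∀ a b, BadAt S pos A a p q → BadAt S pos A b p q → a ≠ b → pos p a ≠ pos p b := by
    rintro a b ⟨x1, y1, -, a1, -⟩ ⟨x2, y2, -, a2, -⟩ hab he
    have sa := h.hA _ _ _ a1
    have sb := h.hA _ _ _ a2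
    have := h.h1 p a b sa sb he.le
    exact hab (h.d0 _ _ ⟨p, sa, sb⟩ (by omega))
  have m1 := inj _ _ hu hv n1
  have m2 := inj _ _ hu hw n2
  have m3 := inj _ _ hv hw n3
  rcases lt_or_gt_of_ne m1 with a | a <;> rcases lt_or_gt_of_ne m2 with b | b <;>
    rcases lt_or_gt_of_ne m3 with c | c
  · exact h.sorted hu hv hw a c
  · exact h.sorted hu hw hv b c
  · omega
  · exact h.sorted hw hu hv b a
  · exact h.sorted hv hu hw a b
  · omega
  · exact h.sorted hv hw hu c b
  · exact h.sorted hw hv hu c a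

lemma triple_count {α : Type} [DecidableEq α] (X : Finset α) (R : α → α → Prop) [DecidableRel R]
    (hR : ∀ a ∈ X, ∀ b ∈ X, ∀ c ∈ X, R a b ∨ R b c ∨ R a c) :
    #X ^ 2 ≤ 3 * #{e ∈ X ×ˢ X | R e.1 e.2} := by
  set N := {e ∈ X ×ˢ X | R e.1 e.2} with hN
  have hsub : X ×ˢ (X ×ˢ X) ⊆
      ((N ×ˢ X).image (fun t => (t.1.1, t.1.2, t.2))) ∪
      ((N ×ˢ X).image (fun t => (t.2, t.1.1, t.1.2))) ∪
      ((N ×ˢ X).image (fun t => (t.1.1, t.2, t.1.2))) := by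
    rintro ⟨a, b, c⟩ ht
    simp only [mem_product] at ht
    have := hR a ht.1 b ht.2.1 c ht.2.2
    simp only [mem_union, mem_image, mem_product, hN, mem_filter, Prod.exists, Prod.mk.injEq]
    rcases this with r | r | r
    · exact .inl (.inl ⟨a, b, c, by tauto⟩)
    · exact .inl (.inr ⟨b, c, a, by tauto⟩)
    · exact .inr ⟨a, c, b, by tauto⟩
  have h1 := card_le_card hsub
  have h2 := h1.trans (card_union_le _ _)
  have h3 := card_union_le ((N ×ˢ X).image (fun t => (t.1.1, t.1.2, t.2)))
      ((N ×ˢ X).image (fun t => (t.2, t.1.1, t.1.2)))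
  have c1 := card_image_le (s := N ×ˢ X) (f := fun t => (t.1.1, t.1.2, t.2))
  have c2 := card_image_le (s := N ×ˢ X) (f := fun t => (t.2, t.1.1, t.1.2))
  have c3 := card_image_le (s := N ×ˢ X) (f := fun t => (t.1.1, t.2, t.1.2))
  simp only [card_product] at *
  rcases Nat.eq_zero_or_pos (#X) with h0 | h0
  · simp [h0]
  · have : #X * (#X * #X) ≤ 3 * (#N * #X) := by omega
    refine le_of_mul_le_mul_left (a := #X) ?_ h0
    nlinarith

open Classical in
lemma Sys.local_bound (h : Sys d S pos A) (P : Finset ι) (v : V) :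
    #{x : V | ∃ q ∈ P, A q x v} ^ 2 ≤ 3 * (#{x : V | ∃ q ∈ P, A q x v} +
      #{e ∈ P ×ˢ P | BadAt S pos A v e.1 e.2}) := by
  set X : Finset V := {x : V | ∃ q ∈ P, A q x v} with hX
  rcases X.eq_empty_or_nonempty with h0 | ⟨x0, hx0⟩
  · simp [h0]
  have hx : ∀ x, x ∈ X → ∃ q ∈ P, A q x v := by simp [hX]
  obtain ⟨q0, -, -⟩ := hx x0 hx0
  have : ∃ o : V → ι, ∀ x ∈ X, o x ∈ P ∧ A (o x) x v := by
    refine ⟨fun x => if hh : x ∈ X then (hx x hh).choose else q0, fun x hh => ?_⟩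
    simp only [hh, dite_true]
    exact (hx x hh).choose_spec
  obtain ⟨o, ho⟩ := this
  have hs : ∀ x ∈ X, S (o x) v := fun x hh => h.hA _ _ _ (ho x hh).2
  have t := triple_count X (fun x y => ¬ AntiAt S pos v (o x) (o y)) (by
    intro a ha b hb c hc
    by_contra hcon
    push Not at hcon
    exact h.no_triangle (hs a ha) (hs b hb) (hs c hc) hcon.1 hcon.2.1 hcon.2.2)
  refine t.trans (Nat.mul_le_mul_left _ ?_)
  rw [← card_filter_add_card_filter_not (p := fun e : V × V => e.1 = e.2)]
  apply Nat.add_le_add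
  · apply card_le_card_of_injOn Prod.fst
    · intro e he
      simp only [coe_filter, mem_filter, mem_product, Set.mem_ofPred_eq] at he
      exact he.1.1.1
    · rintro ⟨a, b⟩ he ⟨c, e⟩ he'
      simp only [coe_filter, mem_filter, mem_product, Set.mem_ofPred_eq] at he he'
      have := he.2
      have := he'.2
      intro h; simp_all
  · apply card_le_card_of_injOn (fun e => (o e.1, o e.2))
    · rintro ⟨a, b⟩ he
      simp only [coe_filter, mem_filter, mem_product, Set.mem_ofPred_eq] at he ⊢
      exact ⟨⟨(ho _ he.1.1.1).1, (ho _ he.1.1.2).1⟩, a, b, he.2, (ho _ he.1.1.1).2, (ho _ he.1.1.2).2, he.1.2⟩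
    · rintro ⟨a, b⟩ he ⟨c, e⟩ he' hh
      simp only [coe_filter, mem_filter, mem_product, Set.mem_ofPred_eq, Prod.mk.injEq] at he he' hh ⊢
      have a1 := (ho _ he.1.1.1).2
      have a2 := (ho _ he.1.1.2).2
      rw [hh.1] at a1
      rw [hh.2] at a2
      exact ⟨h.h4 _ _ _ _ a1 (ho _ he'.1.1.1).2, h.h4 _ _ _ _ a2 (ho _ he'.1.1.2).2⟩

open Classical in
lemma Sys.total (h : Sys d S pos A) (P : Finset ι) :
    (∑ v : V, #{x : V | ∃ q ∈ P, A q x v}) ^ 2 ≤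
      Fintype.card V * (3 * (∑ v : V, #{x : V | ∃ q ∈ P, A q x v}) + 6 * #P ^ 2) := by
  refine (sq_sum_le_card_mul_sum_sq (s := univ)).trans ?_
  rw [card_univ]
  refine Nat.mul_le_mul_left _ ?_
  refine (sum_le_sum fun v _ => h.local_bound P v).trans ?_
  rw [← mul_sum, sum_add_distrib]
  have : ∑ v : V, #{e ∈ P ×ˢ P | BadAt S pos A v e.1 e.2} ≤ #P ^ 2 * 2 := by
    have e := sum_card_bipartiteAbove_eq_sum_card_bipartiteBelow
      (s := (univ : Finset V)) (t := P ×ˢ P) (fun v e => BadAt S pos A v e.1 e.2)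
    unfold bipartiteAbove bipartiteBelow at e
    rw [e]
    refine (sum_le_card_nsmul _ _ 2 fun e _ => h.bad_card e.1 e.2).trans ?_
    simp [card_product, sq]
  omega

lemma Sys.total_exists (h : Sys d S pos A) (P : Finset ι) :
    ∃ F : V → Finset V, (∀ v x q, q ∈ P → A q x v → x ∈ F v) ∧
      (∑ v : V, #(F v)) ^ 2 ≤ Fintype.card V * (3 * (∑ v : V, #(F v)) + 6 * #P ^ 2) := by
  classical
  refine ⟨fun v => {x : V | ∃ q ∈ P, A q x v}, fun v x q hq hA => ?_, h.total P⟩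
  simp only [mem_filter, mem_univ, true_and]
  exact ⟨q, hq, hA⟩

end abs

section graph
variable {V : Type} [DecidableEq V] {G : SimpleGraph V}

lemma geo_dist {u v : V} {W : G.Walk u v} (hW : W.length = G.dist u v) {i j : ℕ}
    (hij : i ≤ j) (hj : j ≤ W.length) : G.dist (W.getVert i) (W.getVert j) = j - i := by
  have h1 : (W.drop i).IsSubwalk W := W.isSubwalk_drop i
  have h2 : ((W.drop i).take (j - i)).IsSubwalk (W.drop i) := (W.drop i).isSubwalk_take (j - i)
  have := SimpleGraph.length_eq_dist_of_subwalk hW (h2.trans h1)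
  have e : (W.drop i).getVert (j - i) = W.getVert j := by
    rw [SimpleGraph.Walk.drop_getVert, Nat.add_sub_cancel' hij]
  rw [← e, ← this]
  simp
  omega

lemma geo_dist0 {u v : V} {W : G.Walk u v} (hW : W.length = G.dist u v) {j : ℕ}
    (hj : j ≤ W.length) : G.dist u (W.getVert j) = j := by
  simpa using geo_dist hW (Nat.zero_le j) hj

lemma cons_getVert {ρ : ∀ u v : V, G.Reachable u v → G.Walk u v}
    (hs : IsShortestPathScheme ρ) (hc : IsConsistentScheme ρ) (u v : V) (h : G.Reachable u v)
    {i j : ℕ} (hij : i ≤ j) (hj : j ≤ (ρ u v h).length) {a b : V}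
    (ha : (ρ u v h).getVert i = a) (hb : (ρ u v h).getVert j = b) (h' : G.Reachable a b)
    {k : ℕ} (hk : k ≤ j - i) : (ρ a b h').getVert k = (ρ u v h).getVert (i + k) := by
  have hW := (hs u v h).2
  have hcc := hc u v h
  generalize ρ u v h = W at *
  have hab := geo_dist hW hij hj
  rw [ha, hb] at hab
  have haS : a ∈ W.support := ha ▸ W.getVert_mem_support i
  have hua := geo_dist0 hW (hij.trans hj)
  rw [ha] at hua
  have l1 : (W.takeUntil a haS).length = i :=
    (SimpleGraph.length_eq_dist_of_subwalk hW (W.isSubwalk_takeUntil haS)).trans hua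
  have hD : ∀ k, (W.dropUntil a haS).getVert k = W.getVert (i + k) := by
    intro k
    conv_rhs => rw [← W.take_spec haS, SimpleGraph.Walk.getVert_append, l1]
    simp
  have hbS : b ∈ (W.dropUntil a haS).support := by
    have := (W.dropUntil a haS).getVert_mem_support (j - i)
    rwa [hD, Nat.add_sub_cancel' hij, hb] at this
  rw [hcc a haS b hbS h', ← hD]
  have l2 : ((W.dropUntil a haS).takeUntil b hbS).length = j - i :=
    (SimpleGraph.length_eq_dist_of_subwalk hW
      (((W.dropUntil a haS).isSubwalk_takeUntil hbS).trans (W.isSubwalk_dropUntil haS))).trans hab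
  conv_rhs => rw [← (W.dropUntil a haS).take_spec hbS, SimpleGraph.Walk.getVert_append', l2,
    if_pos hk]

lemma scheme_sys {ρ : ∀ u v : V, G.Reachable u v → G.Walk u v}
    (hs : IsShortestPathScheme ρ) (hc : IsConsistentScheme ρ) :
    Sys (ι := {p : V × V // G.Reachable p.1 p.2}) (V := V) G.dist
      (fun q a => a ∈ (ρ q.1.1 q.1.2 q.2).support) (fun q a => G.dist q.1.1 a)
      (fun q x v => ∃ i < (ρ q.1.1 q.1.2 q.2).length,
        (ρ q.1.1 q.1.2 q.2).getVert i = x ∧ (ρ q.1.1 q.1.2 q.2).getVert (i + 1) = v) := by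
  have hr : ∀ (q : {p : V × V // G.Reachable p.1 p.2}) (a b : V),
      a ∈ (ρ q.1.1 q.1.2 q.2).support → b ∈ (ρ q.1.1 q.1.2 q.2).support → G.Reachable a b :=
    fun q a b ha hb =>
      (((ρ q.1.1 q.1.2 q.2).takeUntil a ha).reachable.symm).trans
        ((ρ q.1.1 q.1.2 q.2).takeUntil b hb).reachable
  refine ⟨?_, ?_, ?_, ?_, ?_, ?_, ?_⟩
  · rintro a b ⟨q, ha, hb⟩ h
    exact (hr q a b ha hb).dist_eq_zero_iff.1 h
  · exact fun a b => G.dist_comm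
  · rintro a b c ⟨q, ha, hb⟩ -
    exact (hr q a b ha hb).dist_triangle_left c
  · intro q a b ha hb hle
    have hW := (hs q.1.1 q.1.2 q.2).2
    obtain ⟨i, rfl, hi⟩ := SimpleGraph.Walk.mem_support_iff_exists_getVert.1 ha
    obtain ⟨j, rfl, hj⟩ := SimpleGraph.Walk.mem_support_iff_exists_getVert.1 hb
    simp only [geo_dist0 hW hi, geo_dist0 hW hj] at hle ⊢
    rw [geo_dist hW hle hj]
    omega
  · have main : ∀ (p : {p : V × V // G.Reachable p.1 p.2}) (a b x : V) (hab : G.Reachable a b),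
        a ∈ (ρ p.1.1 p.1.2 p.2).support → G.dist p.1.1 a < G.dist p.1.1 b →
        (∃ i < (ρ p.1.1 p.1.2 p.2).length,
        (ρ p.1.1 p.1.2 p.2).getVert i = x ∧ (ρ p.1.1 p.1.2 p.2).getVert (i + 1) = b) →
        (ρ a b hab).getVert (G.dist a b - 1) = x := by
      rintro p a b x hab ha hlt ⟨k, hk, hx, hb⟩
      have hW := (hs p.1.1 p.1.2 p.2).2
      obtain ⟨i, hia, hi⟩ := SimpleGraph.Walk.mem_support_iff_exists_getVert.1 ha
      have e1 := geo_dist0 hW hi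
      have e2 := geo_dist0 hW (Nat.succ_le_of_lt hk)
      rw [hia] at e1
      rw [Nat.succ_eq_add_one, hb] at e2
      have hik : i ≤ k + 1 := by omega
      have e3 := geo_dist hW hik hk
      rw [hia, hb] at e3
      rw [cons_getVert hs hc p.1.1 p.1.2 p.2 hik hk hia hb hab (by omega), ← hx]
      congr 1
      omega
    intro p q a b x y pa qa pb qb h1 h2 A1 A2
    have hab := hr p a b pa pb
    exact (main p a b x hab pa h1 A1).symm.trans (main q a b y hab qa h2 A2)
  · rintro q x y v ⟨i, hi, rfl, hi'⟩ ⟨j, hj, rfl, hj'⟩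
    have hW := (hs q.1.1 q.1.2 q.2).2
    have e1 := geo_dist0 hW (Nat.succ_le_of_lt hi)
    have e2 := geo_dist0 hW (Nat.succ_le_of_lt hj)
    rw [Nat.succ_eq_add_one, hi'] at e1
    rw [Nat.succ_eq_add_one, hj'] at e2
    have : i = j := by omega
    rw [this]
  · rintro q x v ⟨i, hi, -, rfl⟩
    exact SimpleGraph.Walk.getVert_mem_support _ _

end graph

lemma numeric_bound (N M k : ℝ) (hN : 0 ≤ N) (hm0 : 0 ≤ M) (hp0 : 0 ≤ k)
    (ht3 : M ^ 2 ≤ N * (3 * M + 6 * k ^ 2)) : M ≤ 3 * (N + Real.sqrt N * k) := by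
  have hsq := Real.sq_sqrt hN
  have hs0 := Real.sqrt_nonneg N
  generalize Real.sqrt N = s at *
  subst hsq
  by_contra hcon
  push Not at hcon
  have hsk : 0 ≤ s * k := mul_nonneg hs0 hp0
  have hM : 0 < M := by nlinarith [sq_nonneg s]
  have h1 : M * (3 * (s ^ 2 + s * k)) < M * M := mul_lt_mul_of_pos_left hcon hM
  have h2 : 3 * (s * k) * (3 * (s * k)) ≤ M * (3 * (s * k)) :=
    mul_le_mul_of_nonneg_right (by nlinarith [sq_nonneg s]) (by positivity)
  nlinarith [sq_nonneg (s * k)]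

open Classical in
lemma edge_count {V : Type} [Fintype V] {G : SimpleGraph V} (P : Finset (V × V))
    (ρ : ∀ u v : V, G.Reachable u v → G.Walk u v)
    (F : V → Finset V) (hF : ∀ p (h : G.Reachable p.1 p.2), p ∈ P →
      ∀ i < (ρ p.1 p.2 h).length, (ρ p.1 p.2 h).getVert i ∈ F ((ρ p.1 p.2 h).getVert (i + 1))) :
    ({e : Sym2 V | ∃ p ∈ P, ∃ h : G.Reachable p.1 p.2, e ∈ (ρ p.1 p.2 h).edges}).ncard ≤
      ∑ v : V, (F v).card := by
  rw [← Finset.card_sigma]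
  refine le_trans ?_ (Finset.card_image_le (f := fun t : (_ : V) × V => s(t.2, t.1)))
  rw [← Set.ncard_coe_finset]
  refine Set.ncard_le_ncard ?_ (Finset.finite_toSet _)
  rintro e ⟨p, hp, h, he⟩
  induction e using Sym2.ind with
  | _ x y =>
    obtain ⟨i, hi, hxy⟩ := (SimpleGraph.Walk.mk_mem_edges_iff_exists _).1 he
    rw [← hxy]
    simp only [Finset.coe_image, Set.mem_image]
    refine ⟨⟨(ρ p.1 p.2 h).getVert (i + 1), (ρ p.1 p.2 h).getVert i⟩, ?_, rfl⟩
    simp only [Finset.mem_coe, Finset.mem_sigma, Finset.mem_univ, true_and]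
    exact hF p h hp i hi

/-- **Coppersmith–Elkin upper bound for consistent schemes.** There is an absolute constant
`C` such that for every undirected unweighted graph `G` on `n` vertices, every pair set
`P ⊆ V × V` of pairs of vertices in the same connected component, and every consistent
shortest-path tiebreaking scheme `ρ` on `G`, the union `H = ⋃_{p ∈ P} ρ p` has at most
`C · (n + n^(1/2) · |P|)` edges. -/
theorem consistent_scheme_upper_bound :
    ∃ C : ℝ, 0 < C ∧
      ∀ (V : Type) [Fintype V] [DecidableEq V] (G : SimpleGraph V)
        (P : Finset (V × V)), (∀ p ∈ P, G.Reachable p.1 p.2) →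
        ∀ (ρ : ∀ u v : V, G.Reachable u v → G.Walk u v),
          IsShortestPathScheme ρ →
          IsConsistentScheme ρ →
          (({e : Sym2 V | ∃ p ∈ P, ∃ h : G.Reachable p.1 p.2,
              e ∈ (ρ p.1 p.2 h).edges}).ncard : ℝ) ≤
            C * ((Fintype.card V : ℝ) +
              Real.sqrt (Fintype.card V : ℝ) * (P.card : ℝ)) := by
  classical
  refine ⟨3, by norm_num, ?_⟩
  intro V _ _ G P hP ρ hs hc
  obtain ⟨PP, hPP, hPc⟩ : ∃ PP : Finset {p : V × V // G.Reachable p.1 p.2},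
      (∀ p, p.1 ∈ P → p ∈ PP) ∧ PP.card ≤ P.card := by
    refine ⟨P.subtype (fun p => G.Reachable p.1 p.2), fun p hp => by simpa using hp, ?_⟩
    rw [Finset.card_subtype]
    exact Finset.card_filter_le _ _
  obtain ⟨F, hF, ht⟩ := (scheme_sys hs hc).total_exists PP
  have hE := edge_count P ρ F
    (fun p h hp i hi => hF _ _ ⟨p, h⟩ (hPP _ hp) ⟨i, hi, rfl, rfl⟩)
  generalize ∑ v : V, (F v).card = m at ht hE
  have ht2 : m ^ 2 ≤ Fintype.card V * (3 * m + 6 * P.card ^ 2) :=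
    ht.trans (by gcongr)
  have ht3 : (m : ℝ) ^ 2 ≤ Fintype.card V * (3 * m + 6 * (P.card : ℝ) ^ 2) := by
    exact_mod_cast ht2
  refine (Nat.cast_le.2 hE).trans ?_
  exact numeric_bound _ _ _ (Nat.cast_nonneg _) (Nat.cast_nonneg _) (Nat.cast_nonneg _) ht3
end

section
/- There is an absolute constant C such that the following holds. Let G be an undirected unweighted graph on n vertices, let d ≥ 1, let S be a set of vertices such that δ_G(u,v) ≤ d for all u,v ∈ S, and let P be a pair set such that every pair in P has at least one shortest path in G passing through some vertex of S. Then one can choose, for each pair p ∈ P, a shortest path ρ_G(p) between its endpoints such that the union H = ∪_{p∈P} ρ_G(p) has at most C·(n + (n·|P|·|S|·d)^{1/2}) edges. -/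
theorem exists_par_aux {V : Type} [Fintype V] (G : SimpleGraph V) (r : V → ℕ) :
    ∃ par : V → V → V, ∀ x s, G.Reachable x s → x ≠ s →
      G.Adj x (par x s) ∧ G.dist (par x s) s + 1 = G.dist x s ∧
      ∀ y, G.Adj x y → G.dist y s + 1 = G.dist x s → r (par x s) ≤ r y := by
  classical
  have h : ∀ x s, ∃ z, G.Reachable x s → x ≠ s →
      G.Adj x z ∧ G.dist z s + 1 = G.dist x s ∧
      ∀ y, G.Adj x y → G.dist y s + 1 = G.dist x s → r z ≤ r y := by
    intro x s
    by_cases hr : G.Reachable x s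
    · by_cases hne : x = s
      · exact ⟨x, fun _ h => absurd hne h⟩
      · let N : Finset V := Finset.univ.filter fun y => G.Adj x y ∧ G.dist y s + 1 = G.dist x s
        have hN : N.Nonempty := by
          obtain ⟨w, hw⟩ := hr.exists_walk_length_eq_dist
          cases w with
          | nil => exact absurd rfl hne
          | @cons _ y _ hadj w' =>
            refine ⟨y, ?_⟩
            simp only [N, Finset.mem_filter, Finset.mem_univ, true_and]
            refine ⟨hadj, ?_⟩
            have h1 := SimpleGraph.dist_le w'
            obtain ⟨w2, hw2⟩ := w'.reachable.exists_walk_length_eq_dist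
            have h2 := SimpleGraph.dist_le (SimpleGraph.Walk.cons hadj w2)
            simp only [SimpleGraph.Walk.length_cons] at hw h2
            omega
        obtain ⟨z, hz, hmin⟩ := Finset.exists_min_image N r hN
        simp only [N, Finset.mem_filter, Finset.mem_univ, true_and] at hz hmin
        exact ⟨z, fun _ _ => ⟨hz.1, hz.2, fun y h1 h2 => hmin y ⟨h1, h2⟩⟩⟩
    · exact ⟨x, fun h => absurd h hr⟩
  choose par hpar using h
  exact ⟨par, hpar⟩

theorem tri_aux {V : Type} (G : SimpleGraph V) {a b c : V} (h1 : G.Reachable a b)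
    (h2 : G.Reachable b c) : G.dist a c ≤ G.dist a b + G.dist b c := by
  obtain ⟨w1, hw1⟩ := h1.exists_walk_length_eq_dist
  obtain ⟨w2, hw2⟩ := h2.exists_walk_length_eq_dist
  have := SimpleGraph.dist_le (w1.append w2)
  rw [SimpleGraph.Walk.length_append] at this
  omega

open Classical in
theorem walk_aux {V : Type} [Fintype V] (G : SimpleGraph V) (par : V → V → V)
    (hpar : ∀ x s, G.Reachable x s → x ≠ s →
      G.Adj x (par x s) ∧ G.dist (par x s) s + 1 = G.dist x s) (s : V) :
    ∀ (k : ℕ) (u : V), G.Reachable u s → G.dist u s = k →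
      ∃ (W : G.Walk u s) (A : Finset V), W.length = G.dist u s ∧
        (∀ e ∈ W.edges, ∃ x ∈ A, e = s(x, par x s)) ∧
        (∀ x ∈ A, G.Reachable x s ∧ x ≠ s) ∧
        ∀ t, G.Reachable s t →
          (A.filter fun x => G.dist (par x s) t + 1 ≠ G.dist x t).card + G.dist u t
            ≤ G.dist s t + G.dist u s := by
  intro k
  induction k with
  | zero =>
    intro u hr h0
    have : u = s := hr.dist_eq_zero_iff.mp h0
    subst this
    exact ⟨SimpleGraph.Walk.nil, ∅, by simp, by simp, by simp, by simp⟩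
  | succ k ih =>
    intro u hr hk
    have hne : u ≠ s := by
      rintro rfl
      simp at hk
    obtain ⟨hadj, hd⟩ := hpar u s hr hne
    have hr' : G.Reachable (par u s) s := hadj.symm.reachable.trans hr
    obtain ⟨W, A, hW, hE, hA, hB⟩ := ih (par u s) hr' (by omega)
    refine ⟨SimpleGraph.Walk.cons hadj W, insert u A, ?_, ?_, ?_, ?_⟩
    · simp only [SimpleGraph.Walk.length_cons]; omega
    · intro e he
      simp only [SimpleGraph.Walk.edges_cons, List.mem_cons] at he
      rcases he with rfl | he
      · exact ⟨u, by simp, rfl⟩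
      · obtain ⟨x, hx, h⟩ := hE e he
        exact ⟨x, by simp [hx], h⟩
    · intro x hx
      rcases Finset.mem_insert.mp hx with rfl | hx
      · exact ⟨hr, hne⟩
      · exact hA x hx
    · intro t ht
      have h1 := hB t ht
      have h2 : G.dist u t ≤ G.dist (par u s) t + 1 := by
        have := tri_aux G hadj.reachable (hr'.trans ht)
        rw [SimpleGraph.dist_eq_one_iff_adj.mpr hadj] at this
        omega
      rw [Finset.filter_insert]
      split_ifs with hbad
      · have := Finset.card_insert_le u
          (A.filter fun x => G.dist (par x s) t + 1 ≠ G.dist x t)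
        omega
      · omega

/-- **Distance preservers for pairs routed through a low-diameter set.** There is an absolute
constant `C` such that for every undirected unweighted graph `G` on `n` vertices, every
`d ≥ 1`, every vertex set `S` with `δ_G(u,v) ≤ d` for all `u, v ∈ S`, and every pair set `P`
such that every pair in `P` has a shortest path passing through some vertex of `S`, one can
choose a shortest path `ρ p` for each `p ∈ P` so that the union `H = ⋃_{p ∈ P} ρ p` has at
most `C · (n + (n·|P|·|S|·d)^(1/2))` edges. -/
theorem preserver_through_low_diameter_set :
    ∃ C : ℝ, 0 < C ∧
      ∀ (V : Type) [Fintype V] (G : SimpleGraph V) (d : ℕ), 1 ≤ d →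
        ∀ S : Finset V,
          (∀ u ∈ S, ∀ v ∈ S, G.Reachable u v ∧ G.dist u v ≤ d) →
        ∀ P : Finset (V × V),
          (∀ p ∈ P, ∃ s ∈ S, G.Reachable p.1 s ∧ G.Reachable s p.2 ∧
            G.dist p.1 s + G.dist s p.2 = G.dist p.1 p.2) →
        ∃ ρ : (p : V × V) → p ∈ P → G.Walk p.1 p.2,
          (∀ (p : V × V) (hp : p ∈ P),
            (ρ p hp).IsPath ∧ (ρ p hp).length = G.dist p.1 p.2) ∧
          (({e : Sym2 V | ∃ (p : V × V) (hp : p ∈ P), e ∈ (ρ p hp).edges}).ncard : ℝ) ≤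
            C * ((Fintype.card V : ℝ) +
              Real.sqrt ((Fintype.card V : ℝ) * (P.card : ℝ) * (S.card : ℝ) * (d : ℝ))) := by
  classical
  refine ⟨4, by norm_num, ?_⟩
  intro V _ G d hd S hS P hP
  let r : V → ℕ := fun v => (Fintype.equivFin V v : ℕ)
  have hr : Function.Injective r := fun a b h =>
    (Fintype.equivFin V).injective (Fin.ext h)
  obtain ⟨par, hpar⟩ := exists_par_aux G r
  have key : ∀ p : V × V, ∃ (s : V) (B : Finset V), p ∈ P → s ∈ S ∧
      (∀ x ∈ B, G.Reachable x s ∧ x ≠ s) ∧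
      (∀ t ∈ S, (B.filter fun x => G.dist (par x s) t + 1 ≠ G.dist x t).card ≤ 4 * d) ∧
      ∃ W : G.Walk p.1 p.2, W.length = G.dist p.1 p.2 ∧
        ∀ e ∈ W.edges, ∃ x ∈ B, e = s(x, par x s) := by
    intro p
    by_cases hp : p ∈ P
    · obtain ⟨s, hs, h1, h2, h3⟩ := hP p hp
      have hw := walk_aux G par (fun x s h h' => ⟨(hpar x s h h').1, (hpar x s h h').2.1⟩) s
      obtain ⟨W1, A1, hW1, hE1, hA1, hB1⟩ := hw _ p.1 h1 rfl
      obtain ⟨W2, A2, hW2, hE2, hA2, hB2⟩ := hw _ p.2 h2.symm rfl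
      refine ⟨s, A1 ∪ A2, fun _ => ⟨hs, ?_, ?_, W1.append W2.reverse, ?_, ?_⟩⟩
      · intro x hx
        rcases Finset.mem_union.mp hx with hx | hx
        · exact hA1 x hx
        · exact hA2 x hx
      · intro t ht
        obtain ⟨hst, hstd⟩ := hS s hs t ht
        have a1 := hB1 t hst
        have a2 := hB2 t hst
        have b1 := tri_aux G (h1.trans hst) hst.symm
        have b2 := tri_aux G (h2.symm.trans hst) hst.symm
        rw [SimpleGraph.dist_comm (u := t) (v := s)] at b1 b2
        rw [Finset.filter_union]
        have := Finset.card_union_le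
          (A1.filter fun x => G.dist (par x s) t + 1 ≠ G.dist x t)
          (A2.filter fun x => G.dist (par x s) t + 1 ≠ G.dist x t)
        omega
      · rw [SimpleGraph.Walk.length_append, SimpleGraph.Walk.length_reverse, hW1, hW2,
          SimpleGraph.dist_comm (u := p.2) (v := s)]
        exact h3
      · intro e he
        rw [SimpleGraph.Walk.edges_append, SimpleGraph.Walk.edges_reverse] at he
        rcases List.mem_append.mp he with he | he
        · obtain ⟨x, hx, h⟩ := hE1 e he
          exact ⟨x, Finset.mem_union_left _ hx, h⟩
        · obtain ⟨x, hx, h⟩ := hE2 e (List.mem_reverse.mp he)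
          exact ⟨x, Finset.mem_union_right _ hx, h⟩
    · exact ⟨p.1, ∅, fun h => absurd h hp⟩
  choose c B hcB using key
  choose hcS hBr hBbad ρ hρlen hρE using hcB
  refine ⟨ρ, fun p hp => ⟨SimpleGraph.Walk.isPath_of_length_eq_dist _ (hρlen p hp),
    hρlen p hp⟩, ?_⟩
  let D : V → Finset V := fun x => (P.filter fun p => x ∈ B p).image fun p => par x (c p)
  let F : V → Finset ((V × V) × V) := fun x => (P ×ˢ S).filter fun q =>
    x ∈ B q.1 ∧ G.dist (par x (c q.1)) q.2 + 1 ≠ G.dist x q.2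
  have hE : ({e : Sym2 V | ∃ (p : V × V) (hp : p ∈ P), e ∈ (ρ p hp).edges}).ncard
      ≤ ∑ x, (D x).card := by
    rw [← Finset.card_sigma]
    have hsub : {e : Sym2 V | ∃ (p : V × V) (hp : p ∈ P), e ∈ (ρ p hp).edges} ⊆
        (((Finset.univ.sigma D).image fun a : (_ : V) × V => s(a.1, a.2) : Finset (Sym2 V)) :
          Set (Sym2 V)) := by
      rintro e ⟨p, hp, he⟩
      obtain ⟨x, hx, rfl⟩ := hρE p hp e he
      rw [Finset.mem_coe, Finset.mem_image]
      refine ⟨⟨x, par x (c p)⟩, ?_, rfl⟩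
      simp only [Finset.mem_sigma, Finset.mem_univ, true_and, D, Finset.mem_image,
        Finset.mem_filter]
      exact ⟨p, ⟨hp, hx⟩, rfl⟩
    refine (Set.ncard_le_ncard hsub (Finset.finite_toSet _)).trans ?_
    rw [Set.ncard_coe_finset]
    exact Finset.card_image_le
  have hDF : ∀ x, (D x).card ^ 2 ≤ (D x).card + 2 * (F x).card := by
    intro x
    have hlt : ∀ p ∈ P, ∀ q ∈ P, x ∈ B p → x ∈ B q →
        r (par x (c p)) < r (par x (c q)) → (p, c q) ∈ F x := by
      intro p hp q hq hxp hxq hlt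
      simp only [F, Finset.mem_filter, Finset.mem_product]
      refine ⟨⟨hp, hcS q hq⟩, hxp, ?_⟩
      intro heq
      obtain ⟨h1, h2⟩ := hBr p hp x hxp
      obtain ⟨h3, h4⟩ := hBr q hq x hxq
      have := (hpar x (c q) h3 h4).2.2 _ (hpar x (c p) h1 h2).1 heq
      omega
    have hsub : (D x).offDiag ⊆
        ((F x).image fun q => (par x (c q.1), par x q.2)) ∪
        ((F x).image fun q => (par x q.2, par x (c q.1))) := by
      rintro ⟨y, z⟩ hyz
      rw [Finset.mem_offDiag] at hyz
      obtain ⟨hy, hz, hne⟩ := hyz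
      simp only [D, Finset.mem_image, Finset.mem_filter] at hy hz
      obtain ⟨p, ⟨hp, hxp⟩, rfl⟩ := hy
      obtain ⟨q, ⟨hq, hxq⟩, rfl⟩ := hz
      rcases lt_trichotomy (r (par x (c p))) (r (par x (c q))) with h | h | h
      · exact Finset.mem_union_left _
          (Finset.mem_image.mpr ⟨(p, c q), hlt p hp q hq hxp hxq h, rfl⟩)
      · exact absurd (hr h) hne
      · exact Finset.mem_union_right _
          (Finset.mem_image.mpr ⟨(q, c p), hlt q hq p hp hxq hxp h, rfl⟩)
    have h1 := Finset.card_le_card hsub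
    have h2 := Finset.card_union_le ((F x).image fun q => (par x (c q.1), par x q.2))
      ((F x).image fun q => (par x q.2, par x (c q.1)))
    have h3 : ((F x).image fun q => (par x (c q.1), par x q.2)).card ≤ (F x).card :=
      Finset.card_image_le
    have h4 : ((F x).image fun q => (par x q.2, par x (c q.1))).card ≤ (F x).card :=
      Finset.card_image_le
    rw [Finset.offDiag_card] at h1
    rw [pow_two]
    omega
  have hF : ∑ x, (F x).card ≤ P.card * S.card * (4 * d) := by
    have : ∑ x, (F x).card = ∑ q ∈ P ×ˢ S,
        ((B q.1).filter fun x => G.dist (par x (c q.1)) q.2 + 1 ≠ G.dist x q.2).card := by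
      simp only [F, Finset.card_filter]
      rw [Finset.sum_comm]
      refine Finset.sum_congr rfl fun q _ => ?_
      rw [← Finset.sum_filter, ← Finset.sum_filter, ← Finset.filter_filter]
      congr 2
      ext; simp
    rw [this, ← Finset.card_product, ← smul_eq_mul]
    refine Finset.sum_le_card_nsmul _ _ _ fun q hq => ?_
    rw [Finset.mem_product] at hq
    exact hBbad q.1 hq.1 q.2 hq.2
  have hsum : ∑ x, (D x).card ^ 2 ≤ ∑ x, (D x).card + 2 * (P.card * S.card * (4 * d)) := by
    calc ∑ x, (D x).card ^ 2 ≤ ∑ x, ((D x).card + 2 * (F x).card) :=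
          Finset.sum_le_sum fun x _ => hDF x
      _ = ∑ x, (D x).card + 2 * ∑ x, (F x).card := by
          rw [Finset.sum_add_distrib, Finset.mul_sum]
      _ ≤ _ := by omega
  have hcs : (∑ x, (D x).card) ^ 2 ≤ Fintype.card V * ∑ x, (D x).card ^ 2 :=
    sq_sum_le_card_mul_sum_sq
  generalize (∑ x, (D x).card) = M at *
  have hfin : M ^ 2 ≤ Fintype.card V * (M + 2 * (P.card * S.card * (4 * d))) :=
    hcs.trans (Nat.mul_le_mul_left _ hsum)
  have hfinR : (M : ℝ) ^ 2 ≤ (Fintype.card V : ℝ) *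
      (M + 2 * ((P.card : ℝ) * S.card * (4 * d))) := by exact_mod_cast hfin
  refine le_trans (Nat.cast_le.mpr hE) ?_
  set n : ℝ := (Fintype.card V : ℝ) with hn
  have hn0 : 0 ≤ n := by positivity
  have hq0 : 0 ≤ n * (P.card : ℝ) * (S.card : ℝ) * (d : ℝ) := by positivity
  have hM0 : (0 : ℝ) ≤ M := by positivity
  have hs0 := Real.sqrt_nonneg (n * (P.card : ℝ) * (S.card : ℝ) * (d : ℝ))
  have hsq := Real.sq_sqrt hq0
  set w := Real.sqrt (n * (P.card : ℝ) * (S.card : ℝ) * (d : ℝ)) with hw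
  have hMw : (M : ℝ) ^ 2 ≤ n * M + 8 * w ^ 2 := by rw [hsq]; linarith
  by_contra hcon
  push Not at hcon
  nlinarith
end

section
/- Let G be an undirected unweighted graph, and let v_1,…,v_k be vertices with integers r_1,…,r_k ≥ 1 such that every vertex of G lies in some core C_i = B_≤(v_i, r_i); write X_i = B_≤(v_i, 2r_i) for the corresponding cluster. Suppose each index i ∈ {1,…,k} is labeled either 'small' or 'large'. Then every shortest path p in G can be partitioned into consecutive subpaths p_1, …, p_m such that each subpath p_j satisfies one of: (1) every edge of p_j is incident to the core C_i of some small-labeled cluster, or (2) all vertices of p_j are contained in some large-labeled cluster X_i. Moreover, one can assign to each subpath of type (2) a large-labeled cluster containing it so that no two subpaths are assigned the same cluster. -/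
theorem pd_comb {k : ℕ} (core clus : Fin k → ℕ → Prop) (isLarge : Fin k → Bool) (L : ℕ)
    (hcov : ∀ t, ∃ i, core i t)
    (H : ∀ i s e t, core i s → core i e → s ≤ e → e ≤ L → s ≤ t → t ≤ e + 1 → t ≤ L → clus i t) :
    ∀ n s, s + n = L → ∃ (m : ℕ) (f : ℕ → ℕ) (assign : ℕ → Option (Fin k)),
      f 0 = s ∧ f m = L ∧ (∀ j < m, f j < f (j + 1)) ∧
      (∀ j < m,
        (assign j = none ∧ ∀ t, f j ≤ t → t < f (j + 1) →
            ∃ i : Fin k, isLarge i = false ∧ (core i t ∨ core i (t + 1))) ∨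
        (∃ i : Fin k, assign j = some i ∧ isLarge i = true ∧
          ∀ t, f j ≤ t → t ≤ f (j + 1) → clus i t)) ∧
      (∀ j < m, ∀ j' < m, ∀ i : Fin k, assign j = some i → assign j' = some i → j = j') ∧
      (∀ j < m, ∀ i, assign j = some i → ∃ t, s ≤ t ∧ t ≤ L ∧ core i t) := by
  classical
  intro n
  induction n using Nat.strong_induction_on with
  | _ n ih =>
  intro s hs
  rcases Nat.eq_zero_or_pos n with rfl | hn
  · exact ⟨0, fun _ => s, fun _ => none, rfl, by omega, by simp, by simp, by simp, by simp⟩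
  -- one greedy step
  have step : ∃ s' a, s < s' ∧ s' ≤ L ∧
      ((a = none ∧ ∀ t, s ≤ t → t < s' →
            ∃ i : Fin k, isLarge i = false ∧ (core i t ∨ core i (t + 1))) ∨
        (∃ i : Fin k, a = some i ∧ isLarge i = true ∧ ∀ t, s ≤ t → t ≤ s' → clus i t)) ∧
      (∀ i, a = some i → core i s ∧ ∀ t, s' ≤ t → t ≤ L → core i t →
        s' = L ∧ t = L) := by
    obtain ⟨i, hi⟩ := hcov s
    cases hl : isLarge i with
    | false =>
      refine ⟨s + 1, none, by omega, by omega, Or.inl ⟨rfl, ?_⟩, by simp⟩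
      intro t h1 h2
      obtain rfl : t = s := by omega
      exact ⟨i, hl, Or.inl hi⟩
    | true =>
      have hsL : s ≤ L := by omega
      have he1 := Nat.findGreatest_spec (P := core i) hsL hi
      have he2 := Nat.le_findGreatest (P := core i) hsL hi
      have he3 := Nat.findGreatest_le (P := core i) L
      have he4 : ∀ t, Nat.findGreatest (core i) L < t → t ≤ L → ¬ core i t :=
        fun t h1 h2 => Nat.findGreatest_is_greatest h1 h2
      generalize Nat.findGreatest (core i) L = e at *
      refine ⟨min (e + 1) L, some i, by omega, by omega, Or.inr ⟨i, rfl, hl, ?_⟩, ?_⟩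
      · intro t h1 h2
        exact H i s e t hi he1 he2 he3 h1 (by omega) (by omega)
      · rintro i' h
        obtain rfl : i = i' := by simpa using h
        refine ⟨hi, fun t h1 h2 h3 => ?_⟩
        by_cases h : e < t
        · exact absurd h3 (he4 t h h2)
        · omega
  obtain ⟨s', a, h1, h2, h3, h4⟩ := step
  rcases h2.eq_or_lt with h2' | h2'
  · refine ⟨1, fun j => if j = 0 then s else L, fun _ => a, by simp, by simp, ?_, ?_, ?_, ?_⟩
    · intro j hj
      obtain rfl : j = 0 := by omega
      simp; omega
    · intro j hj
      obtain rfl : j = 0 := by omega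
      subst h2'
      simpa using h3
    · intros; omega
    · intro j hj i hi
      exact ⟨s, le_rfl, by omega, (h4 i hi).1⟩
  · obtain ⟨m, f, as, f0, fm, fi, fp, fu, fc⟩ := ih (L - s') (by omega) s' (by omega)
    have key : ∀ j < m, ∀ i, a = some i → as j = some i → False := by
      intro j hj i ha hj'
      obtain ⟨t, t1, t2, t3⟩ := fc j hj i hj'
      have := (h4 i ha).2 t t1 t2 t3
      omega
    refine ⟨m + 1, fun j => Nat.casesOn j s f, fun j => Nat.casesOn j a as, rfl, fm, ?_, ?_, ?_, ?_⟩
    · rintro (_ | j) hj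
      · simpa [f0] using h1
      · exact fi j (by omega)
    · rintro (_ | j) hj
      · simpa [f0] using h3
      · exact fp j (by omega)
    · rintro (_ | j) hj (_ | j') hj' i e1 e2
      · rfl
      · exact (key j' (by omega) i e1 e2).elim
      · exact (key j (by omega) i e2 e1).elim
      · exact congrArg _ (fu j (by omega) j' (by omega) i e1 e2)
    · rintro (_ | j) hj i e1
      · exact ⟨s, le_rfl, by omega, (h4 i e1).1⟩
      · obtain ⟨t, t1, t2, t3⟩ := fc j (by omega) i e1
        exact ⟨t, by omega, t2, t3⟩

theorem pd_sub {V : Type} {G : SimpleGraph V} {x y : V} (p : G.Walk x y) (s d : ℕ) :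
    ∃ q : G.Walk (p.getVert s) (p.getVert (s + d)), q.length ≤ d := by
  induction d with
  | zero => exact ⟨SimpleGraph.Walk.nil, by simp⟩
  | succ d ih =>
    obtain ⟨q, hq⟩ := ih
    by_cases h : s + d < p.length
    · exact ⟨q.append (p.adj_getVert_succ h).toWalk, by simp; omega⟩
    · have e : p.getVert (s + (d + 1)) = p.getVert (s + d) := by
        rw [p.getVert_of_length_le (by omega), p.getVert_of_length_le (by omega)]
      exact ⟨q.copy rfl e.symm, by simp; omega⟩


/-- **Path decomposition over a clustering.** Suppose every vertex of `G` lies in some core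
`C_i = B_≤(v_i, r_i)`, clusters being `X_i = B_≤(v_i, 2 r_i)`, and each index is labeled
small or large. Then every shortest path `p` can be partitioned into consecutive subpaths
(given by breakpoints `f 0 = 0 < f 1 < ⋯ < f m = length p`), each of which either
(1) consists only of edges incident to the core of some small-labeled cluster, or
(2) has all its vertices inside some large-labeled cluster; moreover type-(2) subpaths can
be assigned distinct large-labeled clusters containing them. -/
theorem path_decomposition (V : Type) [Fintype V] (G : SimpleGraph V)
    (k : ℕ) (v : Fin k → V) (rad : Fin k → ℕ) (hrad : ∀ i, 1 ≤ rad i)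
    (hcover : ∀ w : V, ∃ i : Fin k, G.Reachable (v i) w ∧ G.dist (v i) w ≤ rad i)
    (isLarge : Fin k → Bool)
    (x y : V) (p : G.Walk x y) (hp : p.IsPath) (hsp : p.length = G.dist x y) :
    ∃ (m : ℕ) (f : ℕ → ℕ) (assign : ℕ → Option (Fin k)),
      f 0 = 0 ∧ f m = p.length ∧ (∀ j < m, f j < f (j + 1)) ∧
      (∀ j < m,
        -- (1) a small subpath: every edge is incident to the core of some small cluster
        (assign j = none ∧
          ∀ t, f j ≤ t → t < f (j + 1) →
            ∃ i : Fin k, isLarge i = false ∧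
              ((G.Reachable (v i) (p.getVert t) ∧
                  G.dist (v i) (p.getVert t) ≤ rad i) ∨
               (G.Reachable (v i) (p.getVert (t + 1)) ∧
                  G.dist (v i) (p.getVert (t + 1)) ≤ rad i))) ∨
        -- (2) a large subpath: all vertices lie in the assigned large cluster
        (∃ i : Fin k, assign j = some i ∧ isLarge i = true ∧
          ∀ t, f j ≤ t → t ≤ f (j + 1) →
            G.Reachable (v i) (p.getVert t) ∧
              G.dist (v i) (p.getVert t) ≤ 2 * rad i)) ∧
      -- no two subpaths are assigned the same large cluster
      (∀ j < m, ∀ j' < m, ∀ i : Fin k,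
        assign j = some i → assign j' = some i → j = j') := by

  refine pd_comb (fun i t => G.Reachable (v i) (p.getVert t) ∧ G.dist (v i) (p.getVert t) ≤ rad i)
    (fun i t => G.Reachable (v i) (p.getVert t) ∧ G.dist (v i) (p.getVert t) ≤ 2 * rad i)
    isLarge p.length (fun t => hcover _) ?_ p.length 0 (by omega) |>.imp fun m h =>
      h.imp fun f h => h.imp fun a h => ⟨h.1, h.2.1, h.2.2.1, h.2.2.2.1, h.2.2.2.2.1⟩
  rintro i s e t ⟨rs, ds⟩ ⟨re, de⟩ hse heL hst hte htL
  obtain ⟨ws, hws⟩ := rs.exists_walk_length_eq_dist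
  obtain ⟨we, hwe⟩ := re.exists_walk_length_eq_dist
  have hr := hrad i
  -- the shortest path property bounds the length between two core vertices
  have hlen : e - s ≤ 2 * rad i := by
    obtain ⟨q1, hq1⟩ := pd_sub p 0 s
    obtain ⟨q2, hq2⟩ := pd_sub p e (p.length - e)
    have e1 : p.getVert 0 = x := p.getVert_zero
    have e2 : p.getVert (0 + s) = p.getVert s := by rw [Nat.zero_add]
    have e3 : p.getVert (e + (p.length - e)) = y := by
      rw [Nat.add_sub_cancel' heL, p.getVert_length]
    have := SimpleGraph.dist_le
      ((q1.copy e1 e2).append ((ws.reverse.append we).append (q2.copy rfl e3)))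
    simp at this
    omega
  have fin : ∀ q : G.Walk (v i) (p.getVert t), q.length ≤ 2 * rad i →
      G.Reachable (v i) (p.getVert t) ∧ G.dist (v i) (p.getVert t) ≤ 2 * rad i :=
    fun q hq => ⟨⟨q⟩, (SimpleGraph.dist_le q).trans hq⟩
  by_cases hc : t ≤ s + rad i
  · obtain ⟨q, hq⟩ := pd_sub p s (t - s)
    have e1 : p.getVert (s + (t - s)) = p.getVert t := by rw [Nat.add_sub_cancel' hst]
    exact fin (ws.append (q.copy rfl e1)) (by simp; omega)
  · by_cases hte' : t ≤ e
    · obtain ⟨q, hq⟩ := pd_sub p t (e - t)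
      have e1 : p.getVert (t + (e - t)) = p.getVert e := by rw [Nat.add_sub_cancel' hte']
      exact fin (we.append (q.copy rfl e1).reverse) (by simp; omega)
    · obtain ⟨q, hq⟩ := pd_sub p e 1
      have e1 : p.getVert (e + 1) = p.getVert t := by rw [show e + 1 = t by omega]
      exact fin (we.append (q.copy rfl e1)) (by simp; omega)
end

section
/- Assume Hypothesis DP(a,b,C₀) with 2b + a > 1. Then for every d > 0 and every ε > 0 there is a constant C such that for every connected undirected unweighted graph G on n vertices and every subset S of vertices, there exists a subgraph H of G satisfying δ_H(u,v) ≤ δ_G(u,v) + n^d for all u,v ∈ S, with at most C·(n^{1+ε} + |S|^{(2b+a−1)/2}·n^{1−d(1−a)+ε}) edges. -/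
/-- **Hypothesis DP(a, b, C₀):** every undirected unweighted graph on `N` vertices together
with any pair set `P` admits a pairwise distance preserver on at most
`C₀ · (N + N^a · |P|^b)` edges. -/
def DPHyp (a b C₀ : ℝ) : Prop :=
  ∀ (V : Type) [Fintype V] (G : SimpleGraph V) (P : Finset (V × V)),
    ∃ H : SimpleGraph V, H ≤ G ∧
      (∀ p ∈ P, H.dist p.1 p.2 = G.dist p.1 p.2) ∧
      (H.edgeSet.ncard : ℝ) ≤
        C₀ * ((Fintype.card V : ℝ) + (Fintype.card V : ℝ) ^ a * (P.card : ℝ) ^ b)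

def WB {V : Type} (H : SimpleGraph V) (x y : V) (k : ℕ) : Prop :=
  ∃ p : H.Walk x y, p.length ≤ k

namespace WB
variable {V : Type} {H H' : SimpleGraph V} {x y z : V} {k l : ℕ}

lemma refl (x : V) : WB H x x k := ⟨SimpleGraph.Walk.nil, by simp⟩
lemma symm (h : WB H x y k) : WB H y x k := by
  obtain ⟨p, hp⟩ := h
  exact ⟨p.reverse, by simpa using hp⟩
lemma trans (h : WB H x y k) (h' : WB H y z l) : WB H x z (k + l) := by
  obtain ⟨p, hp⟩ := h
  obtain ⟨q, hq⟩ := h'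
  exact ⟨p.append q, by rw [SimpleGraph.Walk.length_append]; omega⟩
lemma mono (hH : H ≤ H') (h : WB H x y k) : WB H' x y k := by
  obtain ⟨p, hp⟩ := h
  exact ⟨p.mapLe hH, by simpa using hp⟩
lemma le (hk : k ≤ l) (h : WB H x y k) : WB H x y l := by
  obtain ⟨p, hp⟩ := h
  exact ⟨p, hp.trans hk⟩
lemma adj (h : H.Adj x y) : WB H x y 1 := ⟨h.toWalk, by simp⟩
lemma dist_le (h : WB H x y k) : H.dist x y ≤ k := by
  obtain ⟨p, hp⟩ := h
  exact (SimpleGraph.dist_le p).trans hp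
lemma reachable (h : WB H x y k) : H.Reachable x y := by
  obtain ⟨p, hp⟩ := h
  exact ⟨p⟩
lemma of_conn (h : H.Connected) (x y : V) : WB H x y (H.dist x y) := by
  obtain ⟨p, hp⟩ := h.exists_walk_length_eq_dist x y
  exact ⟨p, hp.le⟩
lemma chain {π : ℕ → V} {s e : ℕ} (hse : s ≤ e)
    (h : ∀ k, s ≤ k → k < e → H.Adj (π k) (π (k + 1))) : WB H (π s) (π e) (e - s) := by
  induction e, hse using Nat.le_induction with
  | base => exact refl _
  | succ n hn ih =>
    have h1 := ih (fun k hk hk' => h k hk (by omega))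
    exact (h1.trans (adj (h n hn (by omega)))).le (by omega)
/-- A bounded walk of length equal to the `G`-distance yields a function path. -/
lemma exists_fun {G : SimpleGraph V} (hHG : H ≤ G) (h : WB H x y (G.dist x y)) :
    ∃ q : ℕ → V, q 0 = x ∧ q (G.dist x y) = y ∧
      ∀ k < G.dist x y, H.Adj (q k) (q (k + 1)) := by
  obtain ⟨p, hp⟩ := h
  have h2 : G.dist x y ≤ p.length := by
    have := SimpleGraph.dist_le (p.mapLe hHG)
    simpa using this
  have h3 : p.length = G.dist x y := le_antisymm hp h2
  refine ⟨p.getVert, by simp, by rw [← h3]; simp, fun k hk => ?_⟩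
  exact p.adj_getVert_succ (by omega)
end WB

lemma geo_dist_s11 {V : Type} {G : SimpleGraph V} (hG : G.Connected) {π : ℕ → V} {L : ℕ}
    (hL : G.dist (π 0) (π L) = L) (h : ∀ k < L, G.Adj (π k) (π (k + 1)))
    {i j : ℕ} (hij : i ≤ j) (hj : j ≤ L) : G.dist (π i) (π j) = j - i := by
  have a1 := (WB.chain (H := G) (π := π) (Nat.zero_le i) (fun k _ hk => h k (by omega))).dist_le
  have a2 := (WB.chain (H := G) (π := π) hij (fun k _ hk => h k (by omega))).dist_le
  have a3 := (WB.chain (H := G) (π := π) hj (fun k _ hk => h k (by omega))).dist_le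
  have b1 := hG.dist_triangle (u := π 0) (v := π i) (w := π L)
  have b2 := hG.dist_triangle (u := π i) (v := π j) (w := π L)
  omega

open Classical in
/-- Shortest path with a maximal number of edges of `H`. -/
lemma geo_opt {V : Type} {G H : SimpleGraph V} (hG : G.Connected) (hHG : H ≤ G) (u v : V) :
    ∃ π : ℕ → V, π 0 = u ∧ π (G.dist u v) = v ∧
      (∀ k < G.dist u v, G.Adj (π k) (π (k + 1))) ∧
      ∀ f l, f ≤ l → l ≤ G.dist u v → WB H (π f) (π l) (l - f) →
        ∀ k, f ≤ k → k < l → H.Adj (π k) (π (k + 1)) := by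
  set L := G.dist u v with hLdef
  let good : (ℕ → V) → Prop := fun π => π 0 = u ∧ π L = v ∧ ∀ k < L, G.Adj (π k) (π (k + 1))
  let cnt : (ℕ → V) → ℕ := fun π =>
    ((Finset.range L).filter (fun k => H.Adj (π k) (π (k + 1)))).card
  have hcnt : ∀ π, cnt π ≤ L := fun π =>
    (Finset.card_filter_le _ _).trans (by simp)
  have hex : ∃ π, good π := by
    obtain ⟨q, h1, h2, h3⟩ := WB.exists_fun le_rfl (WB.of_conn hG u v)
    exact ⟨q, h1, h2, h3⟩
  obtain ⟨π, hπ, hmax⟩ : ∃ π, good π ∧ ∀ π', good π' → cnt π' ≤ cnt π := by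
    let P : ℕ → Prop := fun n => ∃ π, good π ∧ cnt π = n
    obtain ⟨π0, h0⟩ := hex
    have hP : P (Nat.findGreatest P L) :=
      Nat.findGreatest_spec (P := P) (hcnt π0) ⟨π0, h0, rfl⟩
    obtain ⟨π, h1, h2⟩ := hP
    exact ⟨π, h1, fun π' h' => h2 ▸ Nat.le_findGreatest (hcnt π') ⟨π', h', rfl⟩⟩
  obtain ⟨p0, pL, pA⟩ := hπ
  refine ⟨π, p0, pL, pA, ?_⟩
  intro f l hfl hl hW k hk hkl
  by_contra hbad
  have hd : G.dist (π f) (π l) = l - f := by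
    apply geo_dist_s11 hG (L := L) _ pA hfl hl
    rw [p0, pL]
  rw [← hd] at hW
  obtain ⟨q, q0, q1, qA⟩ := WB.exists_fun hHG hW
  rw [hd] at q1 qA
  let π' : ℕ → V := fun m => if m < f then π m else if m ≤ l then q (m - f) else π m
  have e1 : ∀ m, m ≤ f → π' m = π m := by
    intro m hm
    rcases hm.lt_or_eq with h | h
    · simp [π', h]
    · subst h; simp [π', hfl, q0]
  have e2 : ∀ m, f ≤ m → m ≤ l → π' m = q (m - f) := by
    intro m h1 h2
    simp [π', h2, not_lt.2 h1]
  have e3 : ∀ m, l ≤ m → π' m = π m := by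
    intro m hm
    rcases hm.lt_or_eq with h | h
    · simp only [π']; rw [if_neg (by omega), if_neg (by omega)]
    · subst h; rw [e2 _ hfl le_rfl, q1]
  have eH : ∀ m, f ≤ m → m < l → H.Adj (π' m) (π' (m + 1)) := by
    intro m h1 h2
    rw [e2 m h1 h2.le, e2 (m + 1) (by omega) (by omega),
      show m + 1 - f = (m - f) + 1 by omega]
    exact qA _ (by omega)
  have hg : good π' := by
    refine ⟨by rw [e1 0 (Nat.zero_le _), p0], by rw [e3 L hl, pL], fun m hm => ?_⟩
    by_cases h1 : m < f
    · rw [e1 m h1.le, e1 (m + 1) h1]; exact pA m hm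
    by_cases h2 : m < l
    · exact hHG (eH m (by omega) h2)
    · rw [e3 m (by omega), e3 (m + 1) (by omega)]; exact pA m hm
  have hlt : cnt π < cnt π' := by
    apply Finset.card_lt_card
    rw [Finset.ssubset_iff_of_subset]
    · refine ⟨k, ?_, ?_⟩
      · simp only [Finset.mem_filter, Finset.mem_range]
        exact ⟨by omega, eH k hk hkl⟩
      · simp [hbad]
    · intro m hm
      simp only [Finset.mem_filter, Finset.mem_range] at hm ⊢
      refine ⟨hm.1, ?_⟩
      by_cases h1 : m < f
      · rw [e1 m h1.le, e1 (m + 1) h1]; exact hm.2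
      by_cases h2 : m < l
      · exact eH m (by omega) h2
      · rw [e3 m (by omega), e3 (m + 1) (by omega)]; exact hm.2
  exact absurd (hmax π' hg) (by omega)

open Classical in
lemma jump {V : Type} {H0 : SimpleGraph V} {π : ℕ → V} (core : V → V → Prop)
    (Lg : V → Prop) (e : ℕ) : ∀ (t s : ℕ), s + t = e →
    (∀ m, s ≤ m → m < e → H0.Adj (π m) (π (m + 1)) ∨ ∃ i, Lg i ∧ core i (π m)) →
    ∃ (I : Finset V) (lo hi : V → ℕ),
      (∀ i ∈ I, Lg i ∧ s ≤ lo i ∧ lo i < hi i ∧ hi i ≤ e ∧ core i (π (lo i)) ∧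
        core i (π (hi i - 1))) ∧
      ∀ H : SimpleGraph V, H0 ≤ H → (∀ i ∈ I, WB H (π (lo i)) (π (hi i)) (hi i - lo i)) →
        WB H (π s) (π e) (e - s) ∧
        ∀ i ∈ I, WB H (π s) (π (lo i)) (lo i - s) ∧ WB H (π (lo i)) (π e) (e - lo i) := by
  intro t
  induction t using Nat.strong_induction_on with
  | _ t ih =>
  intro s hst hbad
  rcases Nat.eq_zero_or_pos t with h0 | hpos
  · refine ⟨∅, fun _ => 0, fun _ => 0, by simp, fun H _ _ => ⟨?_, by simp⟩⟩
    have : s = e := by omega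
    subst this
    exact WB.refl _
  rcases hbad s le_rfl (by omega) with hadj | ⟨i, hLi, hci⟩
  · obtain ⟨I, lo, hi, h1, h2⟩ := ih (t - 1) (by omega) (s + 1) (by omega)
      (fun m hm hm' => hbad m (by omega) hm')
    refine ⟨I, lo, hi, fun i hi' => ?_, fun H hH hW => ?_⟩
    · obtain ⟨a, b, c⟩ := h1 i hi'
      exact ⟨a, by omega, c⟩
    · obtain ⟨a, b⟩ := h2 H hH hW
      have hs := WB.adj (hH hadj)
      refine ⟨(hs.trans a).le (by omega), fun i hi' => ⟨(hs.trans (b i hi').1).le ?_, (b i hi').2⟩⟩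
      have := (h1 i hi').2.1
      omega
  · let P : ℕ → Prop := fun m => m < e ∧ core i (π m)
    have hPs : P s := ⟨by omega, hci⟩
    set l := Nat.findGreatest P e with hl
    have hPl : P l := Nat.findGreatest_spec (P := P) (n := e) (by omega) hPs
    have hsl : s ≤ l := Nat.le_findGreatest (by omega) hPs
    have hmaxl : ∀ m, m < e → core i (π m) → m ≤ l := fun m h1 h2 =>
      Nat.le_findGreatest h1.le ⟨h1, h2⟩
    have hle : l < e := hPl.1
    obtain ⟨I, lo, hi, h1, h2⟩ := ih (e - (l + 1)) (by omega) (l + 1) (by omega)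
      (fun m hm hm' => hbad m (by omega) hm')
    have hiI : i ∉ I := by
      intro hmem
      obtain ⟨_, a, b, c, d, _⟩ := h1 i hmem
      have := hmaxl (lo i) (by omega) d
      omega
    have hne : ∀ j ∈ I, j ≠ i := fun j hj hji => hiI (hji ▸ hj)
    refine ⟨insert i I, Function.update lo i s, Function.update hi i (l + 1), ?_, ?_⟩
    · intro j hj
      rcases Finset.mem_insert.1 hj with rfl | hj
      · simp only [Function.update_self]
        exact ⟨hLi, le_rfl, by omega, by omega, hci, by simpa using hPl.2⟩
      · rw [Function.update_of_ne (hne j hj), Function.update_of_ne (hne j hj)]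
        obtain ⟨a, b, c⟩ := h1 j hj
        exact ⟨a, by omega, c⟩
    · intro H hH hW
      have hi0 := hW i (Finset.mem_insert_self _ _)
      simp only [Function.update_self] at hi0
      obtain ⟨a, b⟩ := h2 H hH (fun j hj => by
        have := hW j (Finset.mem_insert_of_mem hj)
        rwa [Function.update_of_ne (hne j hj), Function.update_of_ne (hne j hj)] at this)
      have hse : WB H (π s) (π e) (e - s) := (hi0.trans a).le (by omega)
      refine ⟨hse, fun j hj => ?_⟩
      rcases Finset.mem_insert.1 hj with rfl | hj
      · simp only [Function.update_self]
        exact ⟨WB.refl _, hse⟩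
      · rw [Function.update_of_ne (hne j hj)]
        refine ⟨(hi0.trans (b j hj).1).le ?_, (b j hj).2⟩
        have := (h1 j hj).2.1
        omega

open Classical in
lemma buying {V : Type} (S : Finset V) (I : V × V → Finset V) :
    ∃ Q : Finset (V × V), Q ⊆ S ×ˢ S ∧
      (∀ i, (Q.filter (fun q => i ∈ I q)).card ≤ S.card) ∧
      ∀ q ∈ S ×ˢ S, q ∈ Q ∨ ∃ i ∈ I q,
        (∃ q' ∈ Q, i ∈ I q' ∧ (q'.1 = q.1 ∨ q'.2 = q.1)) ∧
        (∃ q' ∈ Q, i ∈ I q' ∧ (q'.1 = q.2 ∨ q'.2 = q.2)) := by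
  let cov : Finset (V × V) → V → Finset V := fun Q i =>
    S.filter (fun s => ∃ q ∈ Q, i ∈ I q ∧ (q.1 = s ∨ q.2 = s))
  let ok : Finset (V × V) → Prop := fun Q =>
    ∀ i, (Q.filter (fun q => i ∈ I q)).card ≤ (cov Q i).card
  have hne : ((S ×ˢ S).powerset.filter ok).Nonempty := ⟨∅, by simp [ok]⟩
  obtain ⟨Q, hQ, hmax⟩ := Finset.exists_max_image _ Finset.card hne
  simp only [Finset.mem_filter, Finset.mem_powerset] at hQ hmax
  refine ⟨Q, hQ.1, fun i => (hQ.2 i).trans (Finset.card_filter_le _ _), fun q hq => ?_⟩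
  by_contra hcon
  push Not at hcon
  obtain ⟨hqQ, hcon⟩ := hcon
  have hq' := Finset.mem_product.1 hq
  have hok : ok (insert q Q) := by
    intro i
    have hsub : cov Q i ⊆ cov (insert q Q) i := by
      intro s hs
      simp only [cov, Finset.mem_filter] at hs ⊢
      obtain ⟨h1, q', h2, h3⟩ := hs
      exact ⟨h1, q', Finset.mem_insert_of_mem h2, h3⟩
    by_cases hi : i ∈ I q
    · rw [Finset.filter_insert, if_pos hi, Finset.card_insert_of_notMem (by simp [hqQ])]
      have hlt : (cov Q i).card < (cov (insert q Q) i).card := by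
        apply Finset.card_lt_card
        rw [Finset.ssubset_iff_of_subset hsub]
        by_cases h1 : ∃ q' ∈ Q, i ∈ I q' ∧ (q'.1 = q.1 ∨ q'.2 = q.1)
        · refine ⟨q.2, ?_, ?_⟩
          · simp only [cov, Finset.mem_filter]
            exact ⟨hq'.2, q, Finset.mem_insert_self _ _, hi, Or.inr rfl⟩
          · simp only [cov, Finset.mem_filter, not_and]
            rintro _ ⟨q', h2, h3, h4⟩
            have := hcon i hi h1 q' h2 h3
            tauto
        · refine ⟨q.1, ?_, ?_⟩
          · simp only [cov, Finset.mem_filter]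
            exact ⟨hq'.1, q, Finset.mem_insert_self _ _, hi, Or.inl rfl⟩
          · simp only [cov, Finset.mem_filter, not_and]
            exact fun _ => h1
      have := hQ.2 i
      omega
    · rw [Finset.filter_insert, if_neg hi]
      exact (hQ.2 i).trans (Finset.card_le_card hsub)
  have := hmax (insert q Q) ⟨Finset.insert_subset hq hQ.1, hok⟩
  rw [Finset.card_insert_of_notMem hqQ] at this
  omega

/-- Finite ball of radius `k`. -/
noncomputable def Bl {V : Type} [Fintype V] (G : SimpleGraph V) (c : V) (k : ℕ) : Finset V :=
  Finset.univ.filter (fun y => G.dist c y ≤ k)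

lemma mem_Bl {V : Type} [Fintype V] {G : SimpleGraph V} {c y : V} {k : ℕ} :
    y ∈ Bl G c k ↔ G.dist c y ≤ k := by simp [Bl]

lemma tree {V : Type} [Fintype V] {G : SimpleGraph V} (hG : G.Connected) (c : V) (k : ℕ) :
    ∃ T : SimpleGraph V, T ≤ G ∧ T.edgeSet.ncard ≤ (Bl G c k).card ∧
      ∀ y ∈ Bl G c k, WB T c y (G.dist c y) := by
  classical
  have hpar : ∀ y : V, y ≠ c → ∃ z, G.Adj z y ∧ G.dist c z + 1 = G.dist c y := by
    intro y hy
    obtain ⟨q, q0, q1, qA⟩ := WB.exists_fun le_rfl (WB.of_conn hG c y)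
    have hpos : 0 < G.dist c y := hG.pos_dist_of_ne (Ne.symm hy)
    have hd := geo_dist_s11 hG (π := q) (L := G.dist c y) (by rw [q0, q1]) qA
      (i := 0) (j := G.dist c y - 1) (by omega) (by omega)
    refine ⟨q (G.dist c y - 1), ?_, ?_⟩
    · have := qA (G.dist c y - 1) (by omega)
      rwa [show G.dist c y - 1 + 1 = G.dist c y by omega, q1] at this
    · rw [q0] at hd
      omega
  choose! par h1 h2 using hpar
  let T : SimpleGraph V := SimpleGraph.fromEdgeSet
    (Set.image (fun y => s(par y, y)) {y | y ∈ Bl G c k ∧ y ≠ c})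
  have hTadj : ∀ y ∈ Bl G c k, y ≠ c → T.Adj (par y) y := by
    intro y hy hyc
    rw [SimpleGraph.fromEdgeSet_adj]
    exact ⟨⟨y, ⟨hy, hyc⟩, rfl⟩, (h1 y hyc).ne⟩
  refine ⟨T, ?_, ?_, ?_⟩
  · intro x y hxy
    rw [SimpleGraph.fromEdgeSet_adj] at hxy
    obtain ⟨⟨z, ⟨_, hz⟩, he⟩, _⟩ := hxy
    have := h1 z hz
    rw [← SimpleGraph.mem_edgeSet] at this ⊢
    rw [← he]
    exact this
  · have hs : T.edgeSet ⊆ Set.image (fun y => s(par y, y)) (↑(Bl G c k) : Set V) := by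
      intro e he
      rw [SimpleGraph.edgeSet_fromEdgeSet] at he
      obtain ⟨⟨z, ⟨h, _⟩, he⟩, _⟩ := he
      exact ⟨z, h, he⟩
    calc T.edgeSet.ncard ≤ _ := Set.ncard_le_ncard hs (Set.toFinite _)
      _ ≤ (↑(Bl G c k) : Set V).ncard := Set.ncard_image_le (Set.toFinite _)
      _ = _ := Set.ncard_coe_finset _
  · have key : ∀ m : ℕ, ∀ y ∈ Bl G c k, G.dist c y = m → WB T c y m := by
      intro m
      induction m with
      | zero =>
        intro y _ h
        rw [hG.dist_eq_zero_iff] at h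
        subst h
        exact WB.refl _
      | succ m ih =>
        intro y hy h
        have hyc : y ≠ c := by
          rintro rfl
          simp at h
        have e := h2 y hyc
        rw [mem_Bl] at hy
        exact (ih (par y) (mem_Bl.2 (by omega)) (by omega)).trans
          (WB.adj (hTadj y (mem_Bl.2 hy) hyc))
    exact fun y hy => key _ y hy rfl

lemma local_pres {a b C₀ : ℝ} (hDP : DPHyp a b C₀) {V : Type} [Fintype V]
    {G : SimpleGraph V} (hG : G.Connected) (c : V) (r : ℕ) (P : Finset (V × V))
    (hP : ∀ p ∈ P, G.dist c p.1 ≤ 4 * r ∧ G.dist c p.2 ≤ 4 * r) :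
    ∃ H : SimpleGraph V, H ≤ G ∧ (∀ p ∈ P, WB H p.1 p.2 (G.dist p.1 p.2)) ∧
      (H.edgeSet.ncard : ℝ) ≤ C₀ * (((Bl G c (12 * r)).card : ℝ) +
        ((Bl G c (12 * r)).card : ℝ) ^ a * (P.card : ℝ) ^ b) := by
  classical
  set A := Bl G c (12 * r) with hA
  have hcA : c ∈ A := mem_Bl.2 (by simp)
  let f : V → A := fun x => if h : x ∈ A then ⟨x, h⟩ else ⟨c, hcA⟩
  have hf : ∀ x, x ∈ A → ((f x : A) : V) = x := by
    intro x hx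
    simp [f, hx]
  let GA : SimpleGraph A := G.comap (fun x : A => (x : V))
  have hPA : ∀ p ∈ P, p.1 ∈ A ∧ p.2 ∈ A := fun p hp =>
    ⟨mem_Bl.2 (by have := (hP p hp).1; omega), mem_Bl.2 (by have := (hP p hp).2; omega)⟩
  obtain ⟨H, hHG, hHd, hHc⟩ := hDP A GA (P.image (fun p => (f p.1, f p.2)))
  have hmap : ∀ x y : A, H.Adj x y → (H.map (Function.Embedding.subtype _)).Adj (x : V) (y : V) := by
    intro x y h
    rw [SimpleGraph.map_adj]
    exact ⟨x, y, h, rfl, rfl⟩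
  refine ⟨H.map (Function.Embedding.subtype _), ?_, ?_, ?_⟩
  · intro x y h
    rw [SimpleGraph.map_adj] at h
    obtain ⟨x', y', h, rfl, rfl⟩ := h
    exact hHG h
  · intro p hp
    have hWA : WB GA (f p.1) (f p.2) (G.dist p.1 p.2) := by
      obtain ⟨q, q0, q1, qA⟩ := WB.exists_fun le_rfl (WB.of_conn hG p.1 p.2)
      have hqA : ∀ j ≤ G.dist p.1 p.2, q j ∈ A := by
        intro j hj
        have e := geo_dist_s11 hG (π := q) (L := G.dist p.1 p.2) (by rw [q0, q1]) qA
          (i := 0) (j := j) (by omega) hj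
        rw [q0] at e
        have t1 := hG.dist_triangle (u := c) (v := p.1) (w := q j)
        have t2 := hG.dist_triangle (u := p.1) (v := c) (w := p.2)
        have t3 := SimpleGraph.dist_comm (G := G) (u := p.1) (v := c)
        have := hP p hp
        exact mem_Bl.2 (by omega)
      have := WB.chain (H := GA) (π := fun j => f (q j)) (s := 0) (e := G.dist p.1 p.2)
        (Nat.zero_le _) (fun k _ hk => by
          change G.Adj ((f (q k) : A) : V) ((f (q (k + 1)) : A) : V)
          rw [hf _ (hqA k hk.le), hf _ (hqA (k + 1) hk)]
          exact qA k hk)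
      simpa [q0, q1] using this
    have hd := hHd (f p.1, f p.2) (Finset.mem_image.2 ⟨p, hp, rfl⟩)
    simp only at hd
    have hr : H.Reachable (f p.1) (f p.2) := by
      by_cases hne : f p.1 = f p.2
      · rw [hne]
      · apply SimpleGraph.Reachable.of_dist_ne_zero
        rw [hd]
        exact (hWA.reachable.pos_dist_of_ne hne).ne'
    obtain ⟨w, hw⟩ := hr.exists_walk_length_eq_dist
    let φ : H →g (H.map (Function.Embedding.subtype (fun x => x ∈ A))) :=
      ⟨fun x => (x : V), fun {x y} h => hmap x y h⟩
    have : WB (H.map (Function.Embedding.subtype _)) (f p.1 : V) (f p.2 : V)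
        (G.dist p.1 p.2) := by
      refine ⟨w.map φ, ?_⟩
      rw [SimpleGraph.Walk.length_map, hw, hd]
      exact hWA.dist_le
    rwa [hf _ (hPA p hp).1, hf _ (hPA p hp).2] at this
  · rw [SimpleGraph.edgeSet_map]
    have h1 : (Set.image (Function.Embedding.sym2Map (Function.Embedding.subtype (fun x => x ∈ A)))
        H.edgeSet).ncard ≤ H.edgeSet.ncard := Set.ncard_image_le (Set.toFinite _)
    have h2 : (P.image (fun p => (f p.1, f p.2))).card = P.card := by
      apply Finset.card_image_of_injOn
      intro p hp p' hp' h
      simp only [Prod.mk.injEq] at h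
      have e1 := congrArg (fun x : A => (x : V)) h.1
      have e2 := congrArg (fun x : A => (x : V)) h.2
      simp only [hf _ (hPA p hp).1, hf _ (hPA p' hp').1] at e1
      simp only [hf _ (hPA p hp).2, hf _ (hPA p' hp').2] at e2
      exact Prod.ext e1 e2
    rw [h2, Fintype.card_coe] at hHc
    exact le_trans (by exact_mod_cast h1) hHc

lemma ncard_sup {V : Type} [Fintype V] (U : Finset V) (F : V → SimpleGraph V) (w : V → ℝ)
    (h : ∀ c ∈ U, ((F c).edgeSet.ncard : ℝ) ≤ w c) :
    ((U.sup F).edgeSet.ncard : ℝ) ≤ ∑ c ∈ U, w c := by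
  classical
  induction U using Finset.induction_on with
  | empty => simp
  | insert c U hc ih =>
    rw [Finset.sup_insert, Finset.sum_insert hc, SimpleGraph.edgeSet_sup]
    have h1 := Set.ncard_union_le (F c).edgeSet (U.sup F).edgeSet
    have h2 := ih (fun x hx => h x (Finset.mem_insert_of_mem hx))
    have h3 := h c (Finset.mem_insert_self _ _)
    have h4 : (((F c).edgeSet ∪ (U.sup F).edgeSet).ncard : ℝ) ≤
      (F c).edgeSet.ncard + (U.sup F).edgeSet.ncard := by exact_mod_cast h1
    linarith

lemma thin {V : Type} [Fintype V] (G : SimpleGraph V) (c : V) (r : ℕ) (hr : 1 ≤ r) :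
    ∃ ρ, 3 * r + 1 ≤ ρ ∧ ρ ≤ 4 * r ∧
      (Finset.univ.filter (fun y => G.dist c y = ρ)).card * r ≤ (Bl G c (12 * r)).card := by
  classical
  let L : ℕ → Finset V := fun ρ => Finset.univ.filter (fun y => G.dist c y = ρ)
  obtain ⟨ρ, hρ, hmin⟩ := Finset.exists_min_image (Finset.Icc (3 * r + 1) (4 * r))
    (fun ρ => (L ρ).card) ⟨4 * r, by simp; omega⟩
  rw [Finset.mem_Icc] at hρ
  refine ⟨ρ, hρ.1, hρ.2, ?_⟩
  have h1 : ∑ ρ' ∈ Finset.Icc (3 * r + 1) (4 * r), (L ρ).card ≤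
      ∑ ρ' ∈ Finset.Icc (3 * r + 1) (4 * r), (L ρ').card := Finset.sum_le_sum hmin
  rw [Finset.sum_const, Nat.card_Icc, smul_eq_mul,
      show 4 * r + 1 - (3 * r + 1) = r by omega, ← Finset.card_biUnion] at h1
  · rw [mul_comm]
    refine h1.trans (Finset.card_le_card ?_)
    intro y hy
    simp only [Finset.mem_biUnion, Finset.mem_Icc, L, Finset.mem_filter, Finset.mem_univ,
      true_and] at hy
    obtain ⟨m, hm, hy⟩ := hy
    exact mem_Bl.2 (by omega)
  · intro x _ y _ hxy
    rw [Function.onFun, Finset.disjoint_left]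
    intro z hz hz'
    simp only [L, Finset.mem_filter, Finset.mem_univ, true_and] at hz hz'
    omega

lemma clusters {V : Type} [Fintype V] {G : SimpleGraph V} (hG : G.Connected) (R J : ℕ)
    (t : ℝ) (ht : 0 ≤ t) (hJ : (Fintype.card V : ℝ) ≤ t ^ J) (hJ1 : 1 ≤ J) :
    ∃ (U : Finset V) (r : V → ℕ), (∀ c, R ≤ r c ∧ 12 * r c ≤ 12 ^ J * R) ∧
      (∀ x, ∃ c ∈ U, G.dist c x ≤ 3 * r c) ∧
      ∑ c ∈ U, ((Bl G c (12 * r c)).card : ℝ) ≤ t * Fintype.card V := by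
  classical
  have hsc : ∀ c : V, ∃ r, (R ≤ r ∧ 12 * r ≤ 12 ^ J * R) ∧
      ((Bl G c (12 * r)).card : ℝ) ≤ t * (Bl G c r).card := by
    intro c
    by_contra hcon
    push Not at hcon
    have hgt : ∀ j < J, t * ((Bl G c (12 ^ j * R)).card : ℝ) <
        (Bl G c (12 ^ (j + 1) * R)).card := by
      intro j hj
      have := hcon (12 ^ j * R) ⟨Nat.le_mul_of_pos_left _ (by positivity), by
        rw [← mul_assoc, ← pow_succ']
        exact Nat.mul_le_mul_right _ (Nat.pow_le_pow_right (by norm_num) hj)⟩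
      rwa [← mul_assoc, ← pow_succ'] at this
    have hge : ∀ j ≤ J, t ^ j * 1 ≤ ((Bl G c (12 ^ j * R)).card : ℝ) ∧
        (0 < j → t ^ j < ((Bl G c (12 ^ j * R)).card : ℝ)) := by
      intro j
      induction j with
      | zero =>
        intro _
        refine ⟨?_, by simp⟩
        have : 1 ≤ (Bl G c (12 ^ 0 * R)).card :=
          Finset.card_pos.2 ⟨c, mem_Bl.2 (by simp)⟩
        simpa using this
      | succ j ih =>
        intro hj
        have h1 := (ih (by omega)).1
        have h2 := hgt j (by omega)
        have h3 : t ^ (j + 1) ≤ t * ((Bl G c (12 ^ j * R)).card : ℝ) := by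
          rw [pow_succ']
          exact mul_le_mul_of_nonneg_left (by linarith) ht
        exact ⟨by linarith, fun _ => by linarith⟩
    have h1 := (hge J le_rfl).2 hJ1
    have h2 : ((Bl G c (12 ^ J * R)).card : ℝ) ≤ Fintype.card V := by
      exact_mod_cast Finset.card_le_univ _
    linarith
  choose r hr hr2 using hsc
  obtain ⟨u, -, hdis, hcov⟩ := Vitali.exists_disjoint_subfamily_covering_enlargement
    (fun c : V => (↑(Bl G c (r c)) : Set V)) Set.univ (fun c => (r c : ℝ)) 2 (by norm_num)
    (fun _ _ => by positivity) ((12 ^ J * R : ℕ) : ℝ)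
    (fun c _ => by exact_mod_cast (by have := (hr c).2; omega))
    (fun c _ => ⟨c, by simp [mem_Bl]⟩)
  refine ⟨u.toFinset, r, hr, ?_, ?_⟩
  · intro x
    obtain ⟨c, hc, ⟨y, hy1, hy2⟩, hle⟩ := hcov x (Set.mem_univ _)
    refine ⟨c, by simpa using hc, ?_⟩
    have hle' : r x ≤ 2 * r c := by exact_mod_cast hle
    have h1 : G.dist x y ≤ r x := mem_Bl.1 (by simpa using hy1)
    have h2 : G.dist c y ≤ r c := mem_Bl.1 (by simpa using hy2)
    have t1 := hG.dist_triangle (u := c) (v := y) (w := x)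
    have t3 := SimpleGraph.dist_comm (G := G) (u := x) (v := y)
    omega
  · calc ∑ c ∈ u.toFinset, ((Bl G c (12 * r c)).card : ℝ)
        ≤ ∑ c ∈ u.toFinset, t * (Bl G c (r c)).card := Finset.sum_le_sum (fun c _ => hr2 c)
      _ = t * ((∑ c ∈ u.toFinset, (Bl G c (r c)).card : ℕ) : ℝ) := by
        rw [← Finset.mul_sum]; push_cast; rfl
      _ ≤ t * Fintype.card V := by
        apply mul_le_mul_of_nonneg_left _ ht
        rw [← Finset.card_biUnion]
        · exact_mod_cast Finset.card_le_univ _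
        · intro x hx y hy hxy
          have := hdis (by simpa using hx) (by simpa using hy) hxy
          simpa [Function.onFun] using this

lemma num {a b : ℝ} (ha1 : a < 1) (hb0 : 0 < b) (hab : 1 < 2 * b + a)
    {n y R σ : ℝ} (hn : 0 < n) (hy : 0 ≤ y) (hR : 0 < R) (h1 : y ≤ σ)
    (h2 : y * R ^ 2 ≤ n ^ 2) :
    n ^ a * y ^ b ≤ n * (σ ^ ((2 * b + a - 1) / 2) * R ^ (-(1 - a))) := by
  rcases hy.eq_or_lt with rfl | hy
  · rw [Real.zero_rpow hb0.ne', mul_zero]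
    positivity
  have e1 : y ^ b = y ^ ((2 * b + a - 1) / 2) * y ^ ((1 - a) / 2) := by
    rw [← Real.rpow_add hy]; congr 1; ring
  have e2 : y ^ ((2 * b + a - 1) / 2) ≤ σ ^ ((2 * b + a - 1) / 2) :=
    Real.rpow_le_rpow hy.le h1 (by linarith)
  have e3 : y ^ ((1 - a) / 2) ≤ n ^ (1 - a) * R ^ (-(1 - a)) := by
    have h3 : y ≤ (n / R) ^ 2 := by
      rw [div_pow, le_div_iff₀ (by positivity)]
      exact h2
    calc y ^ ((1 - a) / 2) ≤ ((n / R) ^ 2) ^ ((1 - a) / 2) :=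
          Real.rpow_le_rpow hy.le h3 (by linarith)
      _ = (n / R) ^ (1 - a) := by
          rw [← Real.rpow_natCast, ← Real.rpow_mul (by positivity)]
          congr 1; push_cast; ring
      _ = _ := by
          rw [Real.div_rpow hn.le hR.le, Real.rpow_neg hR.le, div_eq_mul_inv]
  have e4 : n ^ a * n ^ (1 - a) = n := by
    rw [← Real.rpow_add hn]; simp
  have hσ : 0 ≤ σ := hy.le.trans h1
  calc n ^ a * y ^ b = n ^ a * (y ^ ((2 * b + a - 1) / 2) * y ^ ((1 - a) / 2)) := by rw [e1]
    _ ≤ n ^ a * (σ ^ ((2 * b + a - 1) / 2) * (n ^ (1 - a) * R ^ (-(1 - a)))) := by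
        gcongr
    _ = (n ^ a * n ^ (1 - a)) * (σ ^ ((2 * b + a - 1) / 2) * R ^ (-(1 - a))) := by ring
    _ = _ := by rw [e4]

lemma per_pair {V : Type} [Fintype V] {G H0 : SimpleGraph V} (hG : G.Connected) (hH0 : H0 ≤ G)
    (U : Finset V) (r ρ : V → ℕ) (hr : ∀ c, 1 ≤ r c)
    (hρ : ∀ c, 3 * r c + 1 ≤ ρ c ∧ ρ c ≤ 4 * r c) (E : ℕ)
    (hcov : ∀ x, ∃ c ∈ U, G.dist c x ≤ 3 * r c)
    (hnear : ∀ c ∈ U, ∀ x y, G.dist c x ≤ 12 * r c → G.dist c y ≤ 12 * r c → WB H0 x y E)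
    (Small : V → Prop)
    (hsmall : ∀ c ∈ U, Small c → ∀ x y, G.dist c x = ρ c → G.dist c y = ρ c →
      WB H0 x y (G.dist x y)) (u v : V) :
    ∃ (I : Finset V) (x y : V → V),
      (∀ i ∈ I, (i ∈ U ∧ ¬ Small i) ∧ G.dist i (x i) ≤ 3 * r i ∧ G.dist i (y i) ≤ 4 * r i ∧
        G.dist u (x i) + G.dist (x i) v = G.dist u v) ∧
      ∀ H : SimpleGraph V, H0 ≤ H → (∀ i ∈ I, WB H (x i) (y i) (G.dist (x i) (y i))) →
        WB H u v (G.dist u v + 2 * E) ∧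
        ∀ i ∈ I, WB H u (x i) (G.dist u (x i) + E) ∧ WB H (x i) v (G.dist (x i) v + E) := by
  classical
  obtain ⟨π, p0, pL, pA, pOpt⟩ := geo_opt hG hH0 u v
  set L := G.dist u v with hL
  have hd : ∀ {i j : ℕ}, i ≤ j → j ≤ L → G.dist (π i) (π j) = j - i := fun hij hj =>
    geo_dist_s11 hG (by rw [p0, pL]) pA hij hj
  have hstep : ∀ c, ∀ k < L, G.dist c (π (k + 1)) ≤ G.dist c (π k) + 1 ∧
      G.dist c (π k) ≤ G.dist c (π (k + 1)) + 1 := by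
    intro c k hk
    have t1 := hG.dist_triangle (u := c) (v := π k) (w := π (k + 1))
    have t2 := hG.dist_triangle (u := c) (v := π (k + 1)) (w := π k)
    have t3 := SimpleGraph.dist_eq_one_iff_adj.2 (pA k hk)
    have t4 := SimpleGraph.dist_eq_one_iff_adj.2 (pA k hk).symm
    omega
  let P1 : ℕ → Prop := fun m => WB H0 u (π m) E
  set s := Nat.findGreatest P1 L with hs
  have hP0 : P1 0 := by
    change WB H0 u (π 0) E
    rw [p0]; exact WB.refl _
  have hPs : WB H0 u (π s) E := Nat.findGreatest_spec (P := P1) (Nat.zero_le _) hP0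
  have hsL : s ≤ L := Nat.findGreatest_le _
  have hsmax : ∀ m ≤ L, WB H0 u (π m) E → m ≤ s := fun m hm h => Nat.le_findGreatest hm h
  have hex : ∃ m, s ≤ m ∧ WB H0 (π m) v E := ⟨L, hsL, by rw [pL]; exact WB.refl _⟩
  set e := Nat.find hex with he
  have hPe : s ≤ e ∧ WB H0 (π e) v E := Nat.find_spec hex
  have heL : e ≤ L := Nat.find_min' hex ⟨hsL, by rw [pL]; exact WB.refl _⟩
  have hemin : ∀ m, s ≤ m → WB H0 (π m) v E → e ≤ m := fun m h1 h2 => Nat.find_min' hex ⟨h1, h2⟩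
  have hbad : ∀ m, s ≤ m → m < e → H0.Adj (π m) (π (m + 1)) ∨
      ∃ i, (i ∈ U ∧ ¬ Small i) ∧ G.dist i (π m) ≤ 3 * r i := by
    intro m hsm hme
    obtain ⟨c, hcU, hc⟩ := hcov (π m)
    by_cases hS : Small c
    swap
    · exact Or.inr ⟨c, ⟨hcU, hS⟩, hc⟩
    left
    have hrc := hr c
    have hρc := hρ c
    have hu : ρ c < G.dist c (π 0) := by
      by_contra hle
      have h1 := (hstep c m (by omega)).1
      have h2 := hnear c hcU (π 0) (π (m + 1)) (by omega) (by omega)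
      rw [p0] at h2
      have := hsmax (m + 1) (by omega) h2
      omega
    have hv : ρ c < G.dist c (π L) := by
      by_contra hle
      have h2 := hnear c hcU (π m) (π L) (by omega) (by omega)
      rw [pL] at h2
      have := hemin m hsm h2
      omega
    let Pf : ℕ → Prop := fun j => ρ c ≤ G.dist c (π j)
    set f := Nat.findGreatest Pf m with hf
    have hPf : ρ c ≤ G.dist c (π f) :=
      Nat.findGreatest_spec (P := Pf) (n := m) (Nat.zero_le _) (show Pf 0 from hu.le)
    have hfm : f ≤ m := Nat.findGreatest_le _
    have hfm' : f ≠ m := by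
      intro h
      rw [h] at hPf
      omega
    have hf1 : G.dist c (π (f + 1)) < ρ c := by
      by_contra hle
      have : f + 1 ≤ f := Nat.le_findGreatest (P := Pf) (n := m) (by omega)
        (show Pf (f + 1) from not_lt.1 hle)
      omega
    have hfe : G.dist c (π f) = ρ c := by
      have := (hstep c f (by omega)).2
      omega
    have hexl : ∃ j, m ≤ j ∧ ρ c ≤ G.dist c (π j) := ⟨L, by omega, hv.le⟩
    set l := Nat.find hexl with hl
    have hPl : m ≤ l ∧ ρ c ≤ G.dist c (π l) := Nat.find_spec hexl
    have hlL : l ≤ L := Nat.find_min' hexl ⟨by omega, hv.le⟩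
    have hml : l ≠ m := by
      intro h
      rw [h] at hPl
      omega
    have hl1 : G.dist c (π (l - 1)) < ρ c := by
      by_contra hle
      have : l ≤ l - 1 := Nat.find_min' hexl ⟨by omega, not_lt.1 hle⟩
      omega
    have hle : G.dist c (π l) = ρ c := by
      have := (hstep c (l - 1) (by omega)).1
      rw [show l - 1 + 1 = l by omega] at this
      omega
    have hW := hsmall c hcU hS (π f) (π l) hfe hle
    rw [hd (by omega) hlL] at hW
    exact pOpt f l (by omega) hlL hW m hfm (by omega)
  obtain ⟨I, lo, hi, h1, h2⟩ := jump (H0 := H0) (π := π) (fun i x => G.dist i x ≤ 3 * r i)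
    (fun i => i ∈ U ∧ ¬ Small i) e (e - s) s (by omega) hbad
  refine ⟨I, fun i => π (lo i), fun i => π (hi i), fun i hiI => ?_, fun H hH hW => ?_⟩
  · obtain ⟨a1, a2, a3, a4, a5, a6⟩ := h1 i hiI
    refine ⟨a1, a5, ?_, ?_⟩
    · have := (hstep i (hi i - 1) (by omega)).1
      rw [show hi i - 1 + 1 = hi i by omega] at this
      have := hr i
      beta_reduce
      omega
    · have b1 := hd (Nat.zero_le (lo i)) (by omega)
      have b2 := hd (i := lo i) (j := L) (by omega) le_rfl
      rw [p0] at b1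
      rw [pL] at b2
      simp only
      omega
  · obtain ⟨c1, c2⟩ := h2 H hH (fun i hiI => by
      obtain ⟨a1, a2, a3, a4, a5, a6⟩ := h1 i hiI
      have := hW i hiI
      rwa [hd a3.le (by omega)] at this)
    have k1 := hPs.mono hH
    have k2 := hPe.2.mono hH
    refine ⟨((k1.trans c1).trans k2).le (by omega), fun i hiI => ?_⟩
    obtain ⟨a1, a2, a3, a4, a5, a6⟩ := h1 i hiI
    have b1 := hd (Nat.zero_le (lo i)) (by omega)
    have b2 := hd (i := lo i) (j := L) (by omega) le_rfl
    rw [p0] at b1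
    rw [pL] at b2
    refine ⟨(k1.trans (c2 i hiI).1).le ?_, ((c2 i hiI).2.trans k2).le ?_⟩
    · simp only
      omega
    · simp only
      omega

lemma assembly {a b C₀ : ℝ} (ha1 : a < 1) (hb0 : 0 < b)
    (hab : 1 < 2 * b + a) (hC : 0 ≤ C₀) (hDP : DPHyp a b C₀) {V : Type} [Fintype V]
    {G : SimpleGraph V} (hG : G.Connected) (S : Finset V) (U : Finset V) (r : V → ℕ) (R F : ℕ)
    (hR : 1 ≤ R) (hr : ∀ c, R ≤ r c ∧ 12 * r c ≤ F)
    (hcov : ∀ x, ∃ c ∈ U, G.dist c x ≤ 3 * r c) :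
    ∃ H : SimpleGraph V, H ≤ G ∧ (∀ u ∈ S, ∀ v ∈ S, WB H u v (G.dist u v + 12 * F)) ∧
      (H.edgeSet.ncard : ℝ) ≤ ∑ c ∈ U, (((Bl G c (12 * r c)).card : ℝ) *
        (1 + C₀ + C₀ * ((S.card : ℝ) ^ ((2 * b + a - 1) / 2) * (R : ℝ) ^ (-(1 - a))))) := by
  classical
  have hr1 : ∀ c, 1 ≤ r c := fun c => hR.trans (hr c).1
  choose ρ hρ1 hρ2 hρ3 using fun c => thin G c (r c) (hr1 c)
  let Ly : V → Finset V := fun c => Finset.univ.filter (fun y => G.dist c y = ρ c)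
  let Small : V → Prop := fun c => (Ly c).card * (Ly c).card ≤ S.card
  choose T hT1 hT2 hT3 using fun c => tree hG c (12 * r c)
  choose PS hPS1 hPS2 hPS3 using fun c => local_pres hDP hG c (r c) (Ly c ×ˢ Ly c)
    (fun p hp => by
      simp only [Ly, Finset.mem_product, Finset.mem_filter, Finset.mem_univ, true_and] at hp
      have := hρ2 c
      omega)
  let H0 : SimpleGraph V := U.sup (fun c => T c ⊔ if Small c then PS c else ⊥)
  have hTH : ∀ c ∈ U, T c ≤ H0 := fun c hc =>
    le_sup_left.trans (Finset.le_sup (f := fun c => T c ⊔ if Small c then PS c else ⊥) hc)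
  have hPSH : ∀ c ∈ U, Small c → PS c ≤ H0 := fun c hc hs => by
    have h1 := Finset.le_sup (f := fun c => T c ⊔ if Small c then PS c else ⊥) hc
    simp only [if_pos hs] at h1
    exact le_sup_right.trans h1
  have hH0G : H0 ≤ G := by
    apply Finset.sup_le
    intro c _
    refine sup_le (hT1 c) ?_
    split_ifs
    · exact hPS1 c
    · exact bot_le
  have hnear : ∀ c ∈ U, ∀ x y, G.dist c x ≤ 12 * r c → G.dist c y ≤ 12 * r c →
      WB H0 x y (2 * F) := by
    intro c hc x y hx hy
    have h1 := ((hT3 c x (mem_Bl.2 hx)).mono (hTH c hc)).symm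
    have h2 := (hT3 c y (mem_Bl.2 hy)).mono (hTH c hc)
    have := (hr c).2
    exact (h1.trans h2).le (by omega)
  choose I x y hI1 hI2 using fun q : V × V => per_pair hG hH0G U r ρ hr1
    (fun c => ⟨hρ1 c, hρ2 c⟩) (2 * F) hcov hnear Small (fun c hc hs x y hx hy =>
      (hPS2 c (x, y) (by simp [Ly, hx, hy])).mono (hPSH c hc hs)) q.1 q.2
  obtain ⟨Q, hQ1, hQ2, hQ3⟩ := buying S I
  let PP : V → Finset (V × V) := fun c =>
    (Q.filter (fun q => c ∈ I q)).image (fun q => (x q c, y q c))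
  have hPPc : ∀ c, (PP c).card ≤ S.card := fun c => Finset.card_image_le.trans (hQ2 c)
  choose PL hPL1 hPL2 hPL3 using fun c => local_pres hDP hG c (r c) (PP c)
    (fun p hp => by
      simp only [PP, Finset.mem_image, Finset.mem_filter] at hp
      obtain ⟨q, ⟨_, hq⟩, rfl⟩ := hp
      have := hI1 q c hq
      simp only
      omega)
  let F' : V → SimpleGraph V := fun c => T c ⊔ if Small c then PS c else PL c
  let H : SimpleGraph V := U.sup F'
  have hH0H : H0 ≤ H := by
    apply Finset.sup_mono_fun
    intro c _
    apply sup_le_sup le_rfl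
    split_ifs
    · exact le_rfl
    · exact bot_le
  have hPLH : ∀ c ∈ U, ¬ Small c → PL c ≤ H := fun c hc hs => by
    have h1 := Finset.le_sup (f := F') hc
    simp only [F', if_neg hs] at h1
    exact le_sup_right.trans h1
  refine ⟨H, ?_, ?_, ?_⟩
  · apply Finset.sup_le
    intro c _
    refine sup_le (hT1 c) ?_
    split_ifs
    · exact hPS1 c
    · exact hPL1 c
  · have hbuy : ∀ q ∈ Q, WB H q.1 q.2 (G.dist q.1 q.2 + 2 * (2 * F)) ∧
        ∀ i ∈ I q, WB H q.1 (x q i) (G.dist q.1 (x q i) + 2 * F) ∧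
          WB H (x q i) q.2 (G.dist (x q i) q.2 + 2 * F) := by
      intro q hq
      apply hI2 q H hH0H
      intro i hi
      have hi' := (hI1 q i hi).1
      exact (hPL2 i (x q i, y q i) (Finset.mem_image.2
        ⟨q, Finset.mem_filter.2 ⟨hq, hi⟩, rfl⟩)).mono (hPLH i hi'.1 hi'.2)
    have hto : ∀ s i, (∃ q' ∈ Q, i ∈ I q' ∧ (q'.1 = s ∨ q'.2 = s)) →
        WB H s i (G.dist s i + 5 * F) := by
      rintro s i ⟨q', hq', hi, hs⟩
      obtain ⟨b1, b2, b3, b4⟩ := hI1 q' i hi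
      have hri := hr i
      have hxi : WB H (x q' i) i (2 * F) :=
        (hnear i b1.1 (x q' i) i (by omega) (by simp)).mono hH0H
      have t1 := hG.dist_triangle (u := s) (v := i) (w := x q' i)
      rcases hs with rfl | rfl
      · exact (((hbuy q' hq').2 i hi).1.trans hxi).le (by omega)
      · have t2 := SimpleGraph.dist_comm (G := G) (u := x q' i) (v := q'.2)
        exact (((hbuy q' hq').2 i hi).2.symm.trans hxi).le (by omega)
    intro u hu v hv
    rcases hQ3 (u, v) (Finset.mem_product.2 ⟨hu, hv⟩) with h | ⟨i, hi, h1, h2⟩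
    · exact (hbuy _ h).1.le (by simp only; omega)
    · have k1 := hto u i h1
      have k2 := (hto v i h2).symm
      obtain ⟨b1, b2, b3, b4⟩ := hI1 (u, v) i hi
      simp only at b4
      have t1 := hG.dist_triangle (u := u) (v := x (u, v) i) (w := i)
      have t2 := hG.dist_triangle (u := v) (v := x (u, v) i) (w := i)
      have t3 := SimpleGraph.dist_comm (G := G) (u := x (u, v) i) (v := v)
      have t4 := SimpleGraph.dist_comm (G := G) (u := x (u, v) i) (v := i)
      have hri := hr i
      exact (k1.trans k2).le (by omega)
  · apply ncard_sup
    intro c _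
    set n := (Bl G c (12 * r c)).card with hn
    have hn0 : 0 < n := Finset.card_pos.2 ⟨c, mem_Bl.2 (by simp)⟩
    have hRr := (hr c).1
    have hLR : (Ly c).card * R ≤ n := le_trans (Nat.mul_le_mul_left _ hRr) (hρ3 c)
    have hgen : ∀ (K : SimpleGraph V) (m : ℕ), m ≤ S.card → m * R ^ 2 ≤ n ^ 2 →
        (K.edgeSet.ncard : ℝ) ≤ C₀ * ((n : ℝ) + (n : ℝ) ^ a * (m : ℝ) ^ b) →
        (K.edgeSet.ncard : ℝ) ≤ C₀ * ((n : ℝ) + n *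
          ((S.card : ℝ) ^ ((2 * b + a - 1) / 2) * (R : ℝ) ^ (-(1 - a)))) := by
      intro K m h1 h2 h3
      refine h3.trans (mul_le_mul_of_nonneg_left ?_ hC)
      have := num ha1 hb0 hab (n := n) (y := m) (R := R) (σ := S.card)
        (by exact_mod_cast hn0) (by positivity) (by exact_mod_cast hR)
        (by exact_mod_cast h1) (by exact_mod_cast h2)
      linarith
    have hX : (((if Small c then PS c else PL c).edgeSet.ncard : ℕ) : ℝ) ≤
        C₀ * ((n : ℝ) + n *
          ((S.card : ℝ) ^ ((2 * b + a - 1) / 2) * (R : ℝ) ^ (-(1 - a)))) := by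
      split_ifs with hs
      · refine hgen _ ((Ly c).card * (Ly c).card) hs ?_ ?_
        · calc (Ly c).card * (Ly c).card * R ^ 2 = ((Ly c).card * R) ^ 2 := by ring
            _ ≤ n ^ 2 := Nat.pow_le_pow_left hLR 2
        · have := hPS3 c
          rwa [Finset.card_product] at this
      · refine hgen _ _ (hPPc c) ?_ (hPL3 c)
        have hs' : S.card < (Ly c).card * (Ly c).card := not_le.1 hs
        calc (PP c).card * R ^ 2 ≤ ((Ly c).card * (Ly c).card) * R ^ 2 :=
              Nat.mul_le_mul_right _ ((hPPc c).trans hs'.le)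
          _ = ((Ly c).card * R) ^ 2 := by ring
          _ ≤ n ^ 2 := Nat.pow_le_pow_left hLR 2
    have h1 : ((F' c).edgeSet.ncard : ℝ) ≤ ((T c).edgeSet.ncard : ℝ) +
        (((if Small c then PS c else PL c).edgeSet.ncard : ℕ) : ℝ) := by
      simp only [F']
      rw [SimpleGraph.edgeSet_sup]
      exact_mod_cast Set.ncard_union_le _ _
    have h2 : ((T c).edgeSet.ncard : ℝ) ≤ n := by exact_mod_cast hT2 c
    calc ((F' c).edgeSet.ncard : ℝ) ≤ n + C₀ * ((n : ℝ) + n *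
          ((S.card : ℝ) ^ ((2 * b + a - 1) / 2) * (R : ℝ) ^ (-(1 - a)))) := by linarith
      _ = _ := by ring

/-- **Sparse subset spanners from distance preservers.** Assume `DP(a,b,C₀)` with
`2b + a > 1`. Then for every `d > 0` and `ε > 0` there is a constant `C` such that every
connected graph `G` on `n` vertices and every vertex subset `S` admit a subgraph `H` with
`δ_H(u,v) ≤ δ_G(u,v) + n^d` for all `u, v ∈ S`, having at most
`C · (n^(1+ε) + |S|^((2b+a-1)/2) · n^(1-d(1-a)+ε))` edges. -/
theorem sparse_subset_spanner (a b C₀ : ℝ) (ha0 : 0 ≤ a) (ha1 : a < 1)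
    (hb0 : 0 < b) (hb1 : b ≤ 1) (hab : 1 < 2 * b + a) (hDP : DPHyp a b C₀)
    (d : ℝ) (hd : 0 < d) (ε : ℝ) (hε : 0 < ε) :
    ∃ C : ℝ, 0 < C ∧
      ∀ (V : Type) [Fintype V] (G : SimpleGraph V), G.Connected →
        ∀ S : Finset V,
        ∃ H : SimpleGraph V, H ≤ G ∧
          (∀ u ∈ S, ∀ v ∈ S, H.Reachable u v ∧
            (H.dist u v : ℝ) ≤ (G.dist u v : ℝ) + (Fintype.card V : ℝ) ^ d) ∧
          (H.edgeSet.ncard : ℝ) ≤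
            C * ((Fintype.card V : ℝ) ^ (1 + ε) +
              (S.card : ℝ) ^ ((2 * b + a - 1) / 2) *
                (Fintype.card V : ℝ) ^ (1 - d * (1 - a) + ε)) := by
  classical
  have hC : 0 ≤ C₀ := by
    obtain ⟨H, -, -, h⟩ := hDP (Fin 1) ⊥ ∅
    have h0 : (0 : ℝ) ≤ (H.edgeSet.ncard : ℝ) := by positivity
    simp [Real.zero_rpow hb0.ne'] at h
    linarith
  set J : ℕ := ⌈1 / ε⌉₊ with hJdef
  have hJ1 : 1 ≤ J := Nat.ceil_pos.2 (by positivity)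
  have hJε : 1 ≤ ε * J := by
    have h := Nat.le_ceil (1 / ε)
    rw [div_le_iff₀ hε] at h
    linarith
  set K : ℝ := 12 * 12 ^ J with hK
  have hK0 : 0 < K := by positivity
  refine ⟨K ^ (2 / d) + (1 + C₀) + C₀ * (2 * K) ^ (1 - a), by positivity, ?_⟩
  intro V _ G hG S
  set n : ℝ := (Fintype.card V : ℝ) with hn
  have hn1 : 1 ≤ n := by
    have : 0 < Fintype.card V := Fintype.card_pos_iff.2 hG.nonempty
    rw [hn]
    exact_mod_cast this
  have hn0 : 0 < n := by linarith
  set σ : ℝ := (S.card : ℝ) ^ ((2 * b + a - 1) / 2) with hσ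
  have hσ0 : 0 ≤ σ := by positivity
  set X : ℝ := n ^ (1 + ε) with hX
  have hX1 : 1 ≤ X := Real.one_le_rpow hn1 (by linarith)
  set Y : ℝ := n ^ (1 - d * (1 - a) + ε) with hY
  have hY0 : 0 ≤ Y := by positivity
  have hσY : 0 ≤ σ * Y := mul_nonneg hσ0 hY0
  have hA0 : 0 ≤ K ^ (2 / d) := by positivity
  have hB0 : 0 ≤ C₀ * (2 * K) ^ (1 - a) := by positivity
  by_cases hsmall : n ^ d < K
  · refine ⟨G, le_rfl, fun u _ v _ => ⟨hG u v, ?_⟩, ?_⟩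
    · have : 0 ≤ n ^ d := by positivity
      linarith
    · have h1 : G.edgeSet.ncard ≤ Fintype.card V ^ 2 := by
        rw [Set.ncard_eq_toFinset_card']
        have h := G.card_edgeFinset_le_card_choose_two
        exact h.trans (Nat.choose_le_pow _ 2)
      have h2 : (G.edgeSet.ncard : ℝ) ≤ n ^ 2 := by
        rw [hn]; exact_mod_cast h1
      have h3 : n ^ 2 ≤ K ^ (2 / d) := by
        have : n ^ 2 = (n ^ d) ^ (2 / d) := by
          rw [← Real.rpow_mul hn0.le, mul_div_cancel₀ _ hd.ne', ← Real.rpow_natCast]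
          norm_num
        rw [this]
        exact Real.rpow_le_rpow (by positivity) hsmall.le (by positivity)
      have h4 : K ^ (2 / d) ≤ (K ^ (2 / d) + (1 + C₀) + C₀ * (2 * K) ^ (1 - a)) * (X + σ * Y) := by
        calc K ^ (2 / d) = K ^ (2 / d) * 1 := by ring
          _ ≤ _ := mul_le_mul (by linarith) (by linarith) zero_le_one (by linarith)
      linarith
  · rw [not_lt] at hsmall
    set R : ℕ := ⌊n ^ d / K⌋₊ with hRdef
    have hq1 : 1 ≤ n ^ d / K := (one_le_div hK0).2 hsmall
    have hR1 : 1 ≤ R := Nat.le_floor (by simpa using hq1)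
    have hRle : (R : ℝ) ≤ n ^ d / K := Nat.floor_le (by positivity)
    have hRge : n ^ d / (2 * K) ≤ R := by
      have h1 := Nat.lt_floor_add_one (n ^ d / K)
      have h2 : (1 : ℝ) ≤ R := by exact_mod_cast hR1
      have h3 : n ^ d / (2 * K) = (n ^ d / K) / 2 := by
        field_simp
      rw [h3]
      have : n ^ d / K < R + 1 := h1
      linarith
    obtain ⟨U, r, hr, hcov, hsum⟩ := clusters hG R J (n ^ ε) (by positivity) (by
      rw [← Real.rpow_natCast, ← Real.rpow_mul hn0.le]
      calc n = n ^ (1 : ℝ) := (Real.rpow_one n).symm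
        _ ≤ _ := Real.rpow_le_rpow_of_exponent_le hn1 hJε) hJ1
    obtain ⟨H, hHG, hHW, hHc⟩ := assembly ha1 hb0 hab hC hDP hG S U r R (12 ^ J * R) hR1 hr hcov
    refine ⟨H, hHG, fun u hu v hv => ⟨(hHW u hu v hv).reachable, ?_⟩, ?_⟩
    · have h1 := (hHW u hu v hv).dist_le
      have h2 : (H.dist u v : ℝ) ≤ (G.dist u v : ℝ) + 12 * (12 ^ J * R) := by exact_mod_cast h1
      have h3 : K * R ≤ n ^ d := by
        rw [le_div_iff₀ hK0] at hRle
        linarith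
      have h4 : (12 : ℝ) * (12 ^ J * R) = K * R := by rw [hK]; ring
      linarith
    · rw [← Finset.sum_mul] at hHc
      have hRp : (R : ℝ) ^ (-(1 - a)) ≤ (2 * K) ^ (1 - a) * n ^ (-(d * (1 - a))) := by
        calc (R : ℝ) ^ (-(1 - a)) ≤ (n ^ d / (2 * K)) ^ (-(1 - a)) :=
              Real.rpow_le_rpow_of_nonpos (by positivity) hRge (by linarith)
          _ = _ := by
            rw [Real.div_rpow (by positivity) (by positivity), ← Real.rpow_mul hn0.le,
              Real.rpow_neg (by positivity : (0 : ℝ) ≤ 2 * K), div_inv_eq_mul, mul_comm]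
            congr 2
            ring
      have eX : n ^ ε * n = X := by
        rw [hX, Real.rpow_add hn0, Real.rpow_one]; ring
      have eY : X * n ^ (-(d * (1 - a))) = Y := by
        rw [hX, hY, ← Real.rpow_add hn0]; congr 1; ring
      calc (H.edgeSet.ncard : ℝ)
          ≤ X * (1 + C₀ + C₀ * (σ * (R : ℝ) ^ (-(1 - a)))) := by
            refine hHc.trans ?_
            rw [← eX]
            exact mul_le_mul_of_nonneg_right hsum (by positivity)
        _ ≤ X * (1 + C₀ + C₀ * (σ * ((2 * K) ^ (1 - a) * n ^ (-(d * (1 - a)))))) := by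
            gcongr
        _ = (1 + C₀) * X + (C₀ * (2 * K) ^ (1 - a)) * (σ * (X * n ^ (-(d * (1 - a))))) := by ring
        _ = (1 + C₀) * X + (C₀ * (2 * K) ^ (1 - a)) * (σ * Y) := by rw [eY]
        _ ≤ _ := by
            have hX0 : 0 ≤ X := by linarith
            nlinarith [mul_nonneg hA0 hX0, mul_nonneg hA0 hσY, mul_nonneg hB0 hX0,
              mul_nonneg hC hσY]
end
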